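/- arXiv:2304.02918 — 10 statements merged into one kernel-verified Lean document; each statement's English description precedes it below -/
import Mathlib

section
/- For every real t > 0, every real ε > 0 and every integer n ≥ 2, there exists a unique vector (a_0, …, a_{n−2}) with a_k ∈ (0,1) for all k = 0, …, n−2 that satisfies the discrete Painlevé II equation a_{k+1} + a_{k−1} = ((k+ε)/t)·(2a_k/(1−a_k²)) for every k = 0, …, n−2, where the boundary values are fixed to a_{−1} = a_{n−1} = 1. -/
/-- Extension of a vector `(a_0, …, a_{n-2})` to integer indices, with all
out-of-range values (in particular `a_{-1}` and `a_{n-1}`) set to `1`. -/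
noncomputable def dpiiExt (n : ℕ) (a : Fin (n - 1) → ℝ) : ℤ → ℝ :=
  fun j => if h : 0 ≤ j ∧ j < (n : ℤ) - 1 then a ⟨j.toNat, by omega⟩ else 1

theorem dpiiExt_apply {n : ℕ} (a : Fin (n - 1) → ℝ) (i : Fin (n - 1)) :
    dpiiExt n a (i : ℤ) = a i := by
  have h : (0 : ℤ) ≤ (i : ℤ) ∧ ((i : ℕ) : ℤ) < (n : ℤ) - 1 := by omega
  simp [dpiiExt, h]

theorem dpiiExt_of_not_mem {n : ℕ} (a : Fin (n - 1) → ℝ) {j : ℤ}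
    (h : ¬ (0 ≤ j ∧ j < (n : ℤ) - 1)) : dpiiExt n a j = 1 :=
  dif_neg h

theorem exists_fin_eq_of_mem {n : ℕ} {j : ℤ} (h0 : 0 ≤ j) (h1 : j < (n : ℤ) - 1) :
    ∃ i : Fin (n - 1), ((i : ℕ) : ℤ) = j :=
  ⟨⟨j.toNat, by omega⟩, by simp [h0]⟩

theorem mul_dpiiExt_le {n : ℕ} {a b : Fin (n - 1) → ℝ} {s : ℝ} (hs : s ≤ 1)
    (h : ∀ i, s * a i ≤ b i) (j : ℤ) : s * dpiiExt n a j ≤ dpiiExt n b j := by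
  by_cases hj : 0 ≤ j ∧ j < (n : ℤ) - 1
  · obtain ⟨i, rfl⟩ := exists_fin_eq_of_mem hj.1 hj.2
    simpa only [dpiiExt_apply] using h i
  · simpa only [dpiiExt_of_not_mem _ hj, mul_one] using hs

theorem dpiiExt_mono {n : ℕ} {a b : Fin (n - 1) → ℝ} (h : a ≤ b) (j : ℤ) :
    dpiiExt n a j ≤ dpiiExt n b j := by
  simpa using mul_dpiiExt_le le_rfl (fun i => by simpa using h i) j

theorem dpiiExt_nonneg {n : ℕ} {a : Fin (n - 1) → ℝ} (h : ∀ i, 0 ≤ a i) (j : ℤ) :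
    0 ≤ dpiiExt n a j := by
  simpa using mul_dpiiExt_le (a := a) zero_le_one (fun i => by simpa using h i) j

/-- The inverse of `x ↦ 2x/(1-x²)` from `[0, ∞)` to `[0, 1)`. -/
noncomputable def dpiiInv (y : ℝ) : ℝ := y / (1 + √(1 + y ^ 2))

theorem dpiiInv_nonneg {y : ℝ} (hy : 0 ≤ y) : 0 ≤ dpiiInv y := by
  unfold dpiiInv; positivity

theorem dpiiInv_pos {y : ℝ} (hy : 0 < y) : 0 < dpiiInv y := by
  unfold dpiiInv; positivity

theorem dpiiInv_lt_one (y : ℝ) : dpiiInv y < 1 := by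
  have h : y < √(1 + y ^ 2) := Real.lt_sqrt_of_sq_lt (by linarith)
  rw [dpiiInv, div_lt_one (by positivity)]
  linarith

theorem dpiiInv_le_dpiiInv {y z : ℝ} (hy : 0 ≤ y) (hyz : y ≤ z) : dpiiInv y ≤ dpiiInv z := by
  have hz : 0 ≤ z := hy.trans hyz
  have h : y * √(1 + z ^ 2) ≤ z * √(1 + y ^ 2) := by
    refine abs_le_of_sq_le_sq' ?_ (by positivity) |>.2
    rw [mul_pow, mul_pow, Real.sq_sqrt (by positivity), Real.sq_sqrt (by positivity)]
    nlinarith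
  rw [dpiiInv, dpiiInv, div_le_div_iff₀ (by positivity) (by positivity)]
  linarith

theorem two_mul_dpiiInv_div {y : ℝ} (hy : 0 ≤ y) :
    2 * dpiiInv y / (1 - dpiiInv y ^ 2) = y := by
  have h0 := dpiiInv_nonneg hy
  have h1 := dpiiInv_lt_one y
  have hs : √(1 + y ^ 2) ^ 2 = 1 + y ^ 2 := Real.sq_sqrt (by positivity)
  rw [div_eq_iff (by nlinarith)]
  have hpos : (1 + √(1 + y ^ 2)) ≠ 0 := by positivity
  unfold dpiiInv
  field_simp
  linear_combination (-y) * hs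

theorem two_mul_div_lt_of_lt_one {s x : ℝ} (hs0 : 0 < s) (hs1 : s < 1) (hx0 : 0 < x)
    (hx1 : x < 1) :
    2 * (s * x) / (1 - (s * x) ^ 2) < s * (2 * x / (1 - x ^ 2)) := by
  have h1 : 0 < 1 - x ^ 2 := by nlinarith
  have h2 : (s * x) ^ 2 < x ^ 2 := by
    have : s * x < x := by nlinarith
    exact pow_lt_pow_left₀ this (by positivity) two_ne_zero
  rw [← mul_div_assoc, div_lt_div_iff₀ (by linarith) h1]
  have : 0 < s * x := by positivity
  nlinarith

/-- `a` takes values in `(0, 1)` and solves the discrete Painlevé II boundary value problem. -/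
def IsDPIISolution (t ε : ℝ) (n : ℕ) (a : Fin (n - 1) → ℝ) : Prop :=
  (∀ k, a k ∈ Set.Ioo (0 : ℝ) 1) ∧
    (∀ k : ℤ, 0 ≤ k → k ≤ (n : ℤ) - 2 →
      dpiiExt n a (k + 1) + dpiiExt n a (k - 1)
        = (((k : ℝ) + ε) / t) * (2 * dpiiExt n a k / (1 - (dpiiExt n a k) ^ 2)))

/-- Two solutions are compared at the index minimizing their ratio: the map
`x ↦ 2x/(1-x²)` is strictly superhomogeneous, so that ratio cannot be below `1`. -/
theorem IsDPIISolution.le {t ε : ℝ} (ht : 0 < t) (hε : 0 < ε) {n : ℕ}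
    {a b : Fin (n - 1) → ℝ} (ha : IsDPIISolution t ε n a) (hb : IsDPIISolution t ε n b) :
    a ≤ b := by
  intro j
  have : Nonempty (Fin (n - 1)) := ⟨j⟩
  obtain ⟨i, hi⟩ := Finite.exists_min (fun i => b i / a i)
  suffices hs : 1 ≤ b i / a i by
    simpa using (le_div_iff₀ (ha.1 j).1).1 (hs.trans (hi j))
  by_contra! hs1
  obtain ⟨hai0, hai1⟩ := ha.1 i
  set s := b i / a i with hs
  have hs0 : 0 < s := div_pos (hb.1 i).1 hai0
  have hbi : b i = s * a i := by rw [hs, div_mul_cancel₀ _ hai0.ne']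
  have hle : ∀ k, s * a k ≤ b k := fun k => (le_div_iff₀ (ha.1 k).1).1 (hi k)
  have hext := mul_dpiiExt_le hs1.le hle
  have ea := ha.2 i (by omega) (by omega)
  have eb := hb.2 i (by omega) (by omega)
  rw [dpiiExt_apply] at ea eb
  rw [hbi] at eb
  have hc : 0 < (((i : ℕ) : ℤ) + ε) / t := by
    have : (0 : ℝ) ≤ (((i : ℕ) : ℤ) : ℝ) := by positivity
    positivity
  have hlt := mul_lt_mul_of_pos_left (two_mul_div_lt_of_lt_one hs0 hs1 hai0 hai1) hc
  rw [← eb, mul_left_comm, ← ea] at hlt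
  linarith [hext (i + 1), hext (i - 1)]

/-- The argument of `dpiiInv` in the fixed-point form of the equation. -/
noncomputable def dpiiArg (t ε : ℝ) (n : ℕ) (a : Fin (n - 1) → ℝ) (k : ℤ) : ℝ :=
  (dpiiExt n a (k + 1) + dpiiExt n a (k - 1)) / (((k : ℝ) + ε) / t)

theorem dpiiArg_nonneg {t ε : ℝ} (ht : 0 < t) (hε : 0 < ε) {n : ℕ} {a : Fin (n - 1) → ℝ}
    (ha : ∀ i, 0 ≤ a i) {k : ℤ} (hk : 0 ≤ k) : 0 ≤ dpiiArg t ε n a k := by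
  have hk' : (0 : ℝ) ≤ k := by exact_mod_cast hk
  have h1 := dpiiExt_nonneg ha (k + 1)
  have h2 := dpiiExt_nonneg ha (k - 1)
  unfold dpiiArg; positivity

theorem dpiiArg_mono {t ε : ℝ} (ht : 0 < t) (hε : 0 < ε) {n : ℕ} {a b : Fin (n - 1) → ℝ}
    (hab : a ≤ b) {k : ℤ} (hk : 0 ≤ k) : dpiiArg t ε n a k ≤ dpiiArg t ε n b k := by
  have hk' : (0 : ℝ) ≤ k := by exact_mod_cast hk
  have h1 := dpiiExt_mono hab (k + 1)
  have h2 := dpiiExt_mono hab (k - 1)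
  unfold dpiiArg; gcongr

theorem exists_dpii_fixed_point {t ε : ℝ} (ht : 0 < t) (hε : 0 < ε) (n : ℕ) :
    ∃ a : Fin (n - 1) → ℝ, (∀ i, 0 ≤ a i) ∧ ∀ i, a i = dpiiInv (dpiiArg t ε n a (i : ℤ)) := by
  have : Fact ((0 : ℝ) ≤ 1) := ⟨zero_le_one⟩
  let F : (Fin (n - 1) → Set.Icc (0 : ℝ) 1) →o (Fin (n - 1) → Set.Icc (0 : ℝ) 1) :=
    { toFun := fun a i => ⟨dpiiInv (dpiiArg t ε n (fun j => a j) (i : ℤ)),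
        dpiiInv_nonneg (dpiiArg_nonneg ht hε (fun j => (a j).2.1) (by omega)),
        (dpiiInv_lt_one _).le⟩
      monotone' := fun a b hab i =>
        dpiiInv_le_dpiiInv (dpiiArg_nonneg ht hε (fun j => (a j).2.1) (by omega))
          (dpiiArg_mono ht hε (fun j => hab j) (by omega)) }
  refine ⟨fun i => F.lfp i, fun i => (F.lfp i).2.1, fun i => ?_⟩
  exact congrArg Subtype.val (congrFun F.map_lfp i).symm

theorem exists_isDPIISolution {t ε : ℝ} (ht : 0 < t) (hε : 0 < ε) (n : ℕ) :
    ∃ a, IsDPIISolution t ε n a := by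
  obtain ⟨a, ha0, ha⟩ := exists_dpii_fixed_point ht hε n
  have hprev : ∀ m : ℕ, 0 < dpiiExt n a ((m : ℤ) - 1) := by
    intro m
    induction m with
    | zero => rw [dpiiExt_of_not_mem _ (by omega)]; exact one_pos
    | succ m ih =>
      rw [Nat.cast_succ, add_sub_cancel_right]
      by_cases hm : m < n - 1
      · have hpos : 0 < dpiiArg t ε n a m := by
          have := dpiiExt_nonneg ha0 ((m : ℤ) + 1)
          unfold dpiiArg
          push_cast
          positivity
        have := dpiiExt_apply a ⟨m, hm⟩
        rw [this, ha]
        exact dpiiInv_pos hpos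
      · rw [dpiiExt_of_not_mem _ (by omega)]; exact one_pos
  refine ⟨a, fun i => ⟨?_, ?_⟩, fun k hk0 hk1 => ?_⟩
  · have := hprev (i + 1)
    rwa [Nat.cast_succ, add_sub_cancel_right, dpiiExt_apply] at this
  · rw [ha]; exact dpiiInv_lt_one _
  · obtain ⟨i, rfl⟩ := exists_fin_eq_of_mem (n := n) hk0 (by omega)
    have hc : 0 < ((((i : ℕ) : ℤ) : ℝ) + ε) / t := by
      push_cast
      positivity
    rw [dpiiExt_apply, ha i, two_mul_dpiiInv_div (dpiiArg_nonneg ht hε ha0 hk0), dpiiArg,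
      mul_div_cancel₀ _ hc.ne']

/-- Existence and uniqueness of the solution of the discrete Painlevé II equation
`a_{k+1} + a_{k-1} = ((k+ε)/t) · 2a_k/(1-a_k²)`, `k = 0, …, n-2`, with boundary
conditions `a_{-1} = a_{n-1} = 1`, such that `a_k ∈ (0,1)` for `k = 0, …, n-2`. -/
theorem dPII_exists_unique (t ε : ℝ) (ht : 0 < t) (hε : 0 < ε) (n : ℕ) (hn : 2 ≤ n) :
    ∃! a : Fin (n - 1) → ℝ,
      (∀ k, a k ∈ Set.Ioo (0 : ℝ) 1) ∧
      (∀ k : ℤ, 0 ≤ k → k ≤ (n : ℤ) - 2 →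
        dpiiExt n a (k + 1) + dpiiExt n a (k - 1)
          = (((k : ℝ) + ε) / t) * (2 * dpiiExt n a k / (1 - (dpiiExt n a k) ^ 2))) := by
  obtain ⟨a, ha⟩ := exists_isDPIISolution ht hε n
  exact ⟨a, ha, fun b hb =>
    le_antisymm (IsDPIISolution.le ht hε hb ha) (IsDPIISolution.le ht hε ha hb)⟩
end

section
/- Let n ≥ 2 and let s_1, …, s_{n−1} be positive real numbers; set s_0 = s_n = 1. Let D be the symmetric tridiagonal (n−1)×(n−1) real matrix with diagonal entries D_{jj} = (√(s_{j−1}) + √(s_{j+1}))/s_j^{3/2} for j = 1,…,n−1 and off-diagonal entries D_{j,j+1} = D_{j+1,j} = −1/√(s_j s_{j+1}) for j = 1,…,n−2, all other entries zero. Then D is positive definite, i.e. xᵀDx > 0 for every nonzero x ∈ ℝ^{n−1}. -/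
open Matrix

/-- Summation by parts for a weighted path with vanishing boundary values: the quadratic form
is a sum over edges of squares. -/
theorem sum_path_eq_sum_edges (m : ℕ) (a z : ℕ → ℝ) (ha : ∀ j ≤ m + 1, 0 < a j)
    (hz0 : z 0 = 0) (hzm : z (m + 1) = 0) :
    ∑ i ∈ Finset.range m,
        z (i + 1) * ((a i + a (i + 2)) / a (i + 1) * z (i + 1) - z i - z (i + 2)) =
      ∑ j ∈ Finset.range (m + 1),
        (a (j + 1) * z j - a j * z (j + 1)) ^ 2 / (a j * a (j + 1)) := by
  have hedge : ∀ j ∈ Finset.range (m + 1),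
      (a (j + 1) * z j - a j * z (j + 1)) ^ 2 / (a j * a (j + 1)) =
        (a (j + 1) / a j * z j ^ 2 - z j * z (j + 1)) +
          (a j / a (j + 1) * z (j + 1) ^ 2 - z j * z (j + 1)) := by
    intro j hj
    have hj := Finset.mem_range.mp hj
    have h1 := (ha j (by omega)).ne'
    have h2 := (ha (j + 1) (by omega)).ne'
    field_simp
    ring
  rw [Finset.sum_congr rfl hedge, Finset.sum_add_distrib, Finset.sum_range_succ',
    Finset.sum_range_succ (fun j => a j / a (j + 1) * z (j + 1) ^ 2 - z j * z (j + 1)), hz0, hzm]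
  simp only [mul_zero, zero_mul, sub_zero, add_zero, ne_eq, OfNat.ofNat_ne_zero,
    not_false_eq_true, zero_pow]
  rw [← Finset.sum_add_distrib]
  refine Finset.sum_congr rfl fun i _ => ?_
  ring

/-- The quadratic form of a weighted path with vanishing boundary values is positive definite. -/
theorem sum_path_pos (m : ℕ) (a z : ℕ → ℝ) (ha : ∀ j ≤ m + 1, 0 < a j)
    (hz0 : z 0 = 0) (hzm : z (m + 1) = 0) (hz : ∃ j ≤ m, z j ≠ 0) :
    0 < ∑ i ∈ Finset.range m,
        z (i + 1) * ((a i + a (i + 2)) / a (i + 1) * z (i + 1) - z i - z (i + 2)) := by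
  rw [sum_path_eq_sum_edges m a z ha hz0 hzm]
  have hnonneg : ∀ j ∈ Finset.range (m + 1),
      0 ≤ (a (j + 1) * z j - a j * z (j + 1)) ^ 2 / (a j * a (j + 1)) := by
    intro j hj
    have hj := Finset.mem_range.mp hj
    have h1 := ha j (by omega)
    have h2 := ha (j + 1) (by omega)
    positivity
  refine lt_of_le_of_ne (Finset.sum_nonneg hnonneg) fun h => ?_
  have hsum := (Finset.sum_eq_zero_iff_of_nonneg hnonneg).mp h.symm
  have hzero : ∀ j ≤ m, z j = 0 := by
    intro j
    induction j with
    | zero => exact fun _ => hz0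
    | succ k ih =>
      intro hk
      have h1 := (ha k (by omega)).ne'
      have h2 := (ha (k + 1) (by omega)).ne'
      simpa [ih (by omega), h1, h2] using hsum k (Finset.mem_range.mpr (by omega))
  obtain ⟨j, hj, hne⟩ := hz
  exact hne (hzero j hj)

/-- The action of a tridiagonal matrix on a vector extended by zero at both ends. -/
theorem tridiagonal_mulVec_apply {m : ℕ} (A : Matrix (Fin m) (Fin m) ℝ) (d l u : ℝ)
    (w : ℕ → ℝ) (hw0 : w 0 = 0) (hwm : w (m + 1) = 0) (i : Fin m) (hd : A i i = d)
    (hu : ∀ j : Fin m, (i : ℕ) + 1 = j → A i j = u)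
    (hl : ∀ j : Fin m, (j : ℕ) + 1 = i → A i j = l)
    (hzero : ∀ j : Fin m, (i : ℕ) ≠ j → (i : ℕ) + 1 ≠ j → (j : ℕ) + 1 ≠ i → A i j = 0) :
    (A *ᵥ fun j => w (j + 1)) i = d * w (i + 1) + u * w (i + 2) + l * w i := by
  have hterm : ∀ j : Fin m, A i j * w (j + 1) =
      (if (j : ℕ) = i then d * w (i + 1) else 0) +
        (if (j : ℕ) = i + 1 then u * w (i + 2) else 0) +
          (if (j : ℕ) + 1 = i then l * w i else 0) := by
    intro j
    by_cases h1 : (j : ℕ) = i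
    · obtain rfl := Fin.ext h1
      simp [hd]
    by_cases h2 : (j : ℕ) = i + 1
    · rw [hu j h2.symm]
      simp [h2, show (i : ℕ) + 1 + 1 ≠ i by omega]
    by_cases h3 : (j : ℕ) + 1 = i
    · rw [hl j h3]
      simp [h1, h2, h3]
    · rw [hzero j (Ne.symm h1) (Ne.symm h2) h3]
      simp [h1, h2, h3]
  have hi := i.isLt
  simp only [mulVec, dotProduct, hterm]
  rw [Fin.sum_univ_eq_sum_range (fun j => (if j = (i : ℕ) then d * w (i + 1) else 0) +
    (if j = (i : ℕ) + 1 then u * w (i + 2) else 0) + (if j + 1 = (i : ℕ) then l * w i else 0)),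
    Finset.sum_add_distrib, Finset.sum_add_distrib, Finset.sum_ite_eq', Finset.sum_ite_eq',
    if_pos (Finset.mem_range.mpr hi)]
  congr 1
  · congr 1
    split_ifs with h
    · rfl
    · have : (i : ℕ) + 2 = m + 1 := by
        have := Finset.mem_range.not.mp h
        omega
      simp [this, hwm]
  · generalize (i : ℕ) = k at hi ⊢
    cases k with
    | zero => simp [hw0]
    | succ k =>
      simp only [add_left_inj, Finset.sum_ite_eq', Finset.mem_range]
      rw [if_pos (by omega)]

/-- The symmetric tridiagonal matrix `D` with diagonal entries
`D_{jj} = (√(s_{j-1}) + √(s_{j+1}))/s_j^{3/2}` (for `j = 1,…,n-1`) and off-diagonal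
entries `D_{j,j+1} = D_{j+1,j} = -1/√(s_j s_{j+1})`, where `s_0 = s_n = 1` and
`s_1, …, s_{n-1} > 0`, is positive definite. Here the matrix index `i : Fin (n-1)`
corresponds to `j = i + 1`. -/
theorem tridiagonal_posDef (n : ℕ) (hn : 2 ≤ n) (s : ℕ → ℝ)
    (hs0 : s 0 = 1) (hsn : s n = 1)
    (hpos : ∀ j, 1 ≤ j → j ≤ n - 1 → 0 < s j)
    (D : Matrix (Fin (n - 1)) (Fin (n - 1)) ℝ)
    (hdiag : ∀ i : Fin (n - 1),
      D i i = (Real.sqrt (s (i : ℕ)) + Real.sqrt (s ((i : ℕ) + 2)))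
        / (s ((i : ℕ) + 1)) ^ ((3 : ℝ) / 2))
    (hoff : ∀ i j : Fin (n - 1), ((i : ℕ) + 1 = (j : ℕ) ∨ (j : ℕ) + 1 = (i : ℕ)) →
      D i j = -(1 / Real.sqrt (s ((i : ℕ) + 1) * s ((j : ℕ) + 1))))
    (hzero : ∀ i j : Fin (n - 1), (i : ℕ) ≠ (j : ℕ) → (i : ℕ) + 1 ≠ (j : ℕ) →
      (j : ℕ) + 1 ≠ (i : ℕ) → D i j = 0) :
    ∀ x : Fin (n - 1) → ℝ, x ≠ 0 → 0 < x ⬝ᵥ (D *ᵥ x) := by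
  obtain ⟨m, rfl⟩ : ∃ m, n = m + 1 := ⟨n - 1, by omega⟩
  change Matrix (Fin m) (Fin m) ℝ at D
  change ∀ x : Fin m → ℝ, x ≠ 0 → 0 < x ⬝ᵥ (D *ᵥ x)
  intro x hx
  have hs : ∀ j ≤ m + 1, 0 < s j := by
    intro j hj
    rcases Nat.eq_zero_or_pos j with rfl | h0
    · simp [hs0]
    rcases hj.eq_or_lt with rfl | h1
    · simp [hsn]
    · exact hpos j h0 (by omega)
  have ha : ∀ j ≤ m + 1, 0 < √(s j) := fun j hj => Real.sqrt_pos.mpr (hs j hj)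
  let w : ℕ → ℝ := fun k => if h : 1 ≤ k ∧ k ≤ m then x ⟨k - 1, by omega⟩ else 0
  have hw0 : w 0 = 0 := by simp [w]
  have hwm : w (m + 1) = 0 := by simp [w]
  have hxw : x = fun i : Fin m => w (i + 1) := by
    ext i
    simp [w, Nat.succ_le_iff]
  have hform : x ⬝ᵥ (D *ᵥ x) = ∑ i ∈ Finset.range m, w (i + 1) / √(s (i + 1)) *
      ((√(s i) + √(s (i + 2))) / √(s (i + 1)) * (w (i + 1) / √(s (i + 1))) -
        w i / √(s i) - w (i + 2) / √(s (i + 2))) := by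
    rw [hxw, dotProduct, ← Fin.sum_univ_eq_sum_range (fun i => w (i + 1) / √(s (i + 1)) *
      ((√(s i) + √(s (i + 2))) / √(s (i + 1)) * (w (i + 1) / √(s (i + 1))) -
        w i / √(s i) - w (i + 2) / √(s (i + 2))))]
    refine Finset.sum_congr rfl fun i _ => ?_
    have hi := i.isLt
    have h0 := ha i (by omega)
    have h1 := ha (i + 1) (by omega)
    have h2 := ha (i + 2) (by omega)
    have hs1 := (hs (i + 1) (by omega)).le
    have hpow : s ((i : ℕ) + 1) ^ ((3 : ℝ) / 2) = √(s (i + 1)) ^ 3 := by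
      rw [Real.sqrt_eq_rpow, ← Real.rpow_natCast, ← Real.rpow_mul hs1]
      norm_num
    rw [tridiagonal_mulVec_apply D ((√(s i) + √(s (i + 2))) / √(s (i + 1)) ^ 3)
      (-(1 / (√(s (i + 1)) * √(s i)))) (-(1 / (√(s (i + 1)) * √(s (i + 2))))) w hw0 hwm i
      (by rw [hdiag, hpow])
      (fun j hj => by rw [hoff i j (Or.inl hj), ← hj, Real.sqrt_mul hs1])
      (fun j hj => by rw [hoff i j (Or.inr hj), hj, Real.sqrt_mul hs1]) (hzero i)]
    field_simp
    ring
  rw [hform]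
  refine sum_path_pos m (fun j => √(s j)) (fun j => w j / √(s j)) ha (by simp [hw0])
    (by simp [hwm]) ?_
  obtain ⟨i, hi⟩ := Function.ne_iff.mp hx
  rw [hxw] at hi
  exact ⟨i + 1, i.isLt, div_ne_zero hi (ha _ (by omega)).ne'⟩
end

section
/- Let ω ∈ (−∞, +∞] and let u : (−∞, ω) → ℝ be twice differentiable with u''(x) = 2x·u(x) + 2u(x)³ for all x < ω. Assume that the function s ↦ u(s)² + s is absolutely integrable on (−∞, x] for every x < ω, and that u'(x) → 0 and u(x)² + x → 0 as x → −∞. Then for every x < ω one has (u'(x))² + 2·∫_{−∞}^x (u(s)² + s) ds = (u(x)² + x)². -/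
open Filter MeasureTheory Topology

/-- Integrated form of the (alternative form of the) Painlevé II equation
`u'' = 2xu + 2u³`: if `u` is a solution on `(-∞, ω)` with `u'(x) → 0` and
`u(x)² + x → 0` as `x → -∞`, and `s ↦ u(s)² + s` is absolutely integrable on
`(-∞, x]` for every `x < ω`, then
`(u'(x))² + 2∫_{-∞}^x (u(s)² + s) ds = (u(x)² + x)²` for every `x < ω`. -/
theorem PII_integrated_form (ω : EReal) (u u' u'' : ℝ → ℝ)
    (hd1 : ∀ x : ℝ, (x : EReal) < ω → HasDerivAt u (u' x) x)
    (hd2 : ∀ x : ℝ, (x : EReal) < ω → HasDerivAt u' (u'' x) x)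
    (hode : ∀ x : ℝ, (x : EReal) < ω → u'' x = 2 * x * u x + 2 * (u x) ^ 3)
    (hint : ∀ x : ℝ, (x : EReal) < ω →
      IntegrableOn (fun s : ℝ => (u s) ^ 2 + s) (Set.Iic x))
    (hlim1 : Tendsto u' atBot (𝓝 0))
    (hlim2 : Tendsto (fun x : ℝ => (u x) ^ 2 + x) atBot (𝓝 0)) :
    ∀ x : ℝ, (x : EReal) < ω →
      (u' x) ^ 2 + 2 * ∫ s in Set.Iic x, ((u s) ^ 2 + s) = ((u x) ^ 2 + x) ^ 2 := by
  intro x hx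
  have hderiv : ∀ s ∈ Set.Iic x, HasDerivAt
      (fun s => ((u s) ^ 2 + s) ^ 2 - (u' s) ^ 2) (2 * ((u s) ^ 2 + s)) s := by
    intro s hs
    have hsω : (s : EReal) < ω := (EReal.coe_le_coe_iff.2 hs).trans_lt hx
    refine (((((hd1 s hsω).fun_pow 2).fun_add (hasDerivAt_id' s)).fun_pow 2).fun_sub
      ((hd2 s hsω).fun_pow 2)).congr_deriv ?_
    rw [hode s hsω]
    ring
  have hlim : Tendsto (fun s => ((u s) ^ 2 + s) ^ 2 - (u' s) ^ 2) atBot (𝓝 0) := by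
    simpa using (hlim2.pow 2).sub (hlim1.pow 2)
  have h := integral_Iic_of_hasDerivAt_of_tendsto' hderiv ((hint x hx).const_mul 2) hlim
  rw [integral_const_mul] at h
  linarith
end

section
/- Let ω ∈ (−∞, +∞] and let u : (−∞, ω) → ℝ be twice differentiable with u''(x) = 2x·u(x) + 2u(x)³ for all x < ω, and assume u(x) − √(−x) → 0 as x → −∞. If u(x₀) > √(−x₀) for some x₀ < min(ω, 0), then u(x) > √(−x) for all x ∈ (x₀, min(ω, 0)). -/
open Filter Topology

/-- Second-order necessary condition at a local maximum. -/
theorem IsLocalMax.second_deriv_nonpos {f g : ℝ → ℝ} {p c : ℝ} (hmax : IsLocalMax f p)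
    (hf : ∀ᶠ x in 𝓝 p, HasDerivAt f (g x) x) (hg : HasDerivAt g c p) : c ≤ 0 := by
  by_contra! hc
  have hfg : deriv f =ᶠ[𝓝 p] g := hf.mono fun x hx => hx.deriv
  have hdd : deriv (deriv f) p = c := hfg.deriv_eq.trans hg.deriv
  have hmin : IsLocalMin f p :=
    isLocalMin_of_deriv_deriv_pos (hdd ▸ hc) hmax.deriv_eq_zero hf.self_of_nhds.continuousAt
  have hconst : f =ᶠ[𝓝 p] fun _ => f p := by
    filter_upwards [hmax, hmin] with x h₁ h₂ using le_antisymm h₁ h₂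
  have hzero : deriv (deriv f) p = 0 := by
    rw [hconst.deriv.deriv_eq]
    simp
  exact hc.ne' (hdd.symm.trans hzero)

theorem hasDerivAt_sqrt_neg {x : ℝ} (hx : x < 0) :
    HasDerivAt (fun y : ℝ => √(-y)) (-(1 / (2 * √(-x)))) x :=
  ((hasDerivAt_neg x).sqrt (neg_ne_zero.2 hx.ne)).congr_deriv (by ring)

theorem hasDerivAt_inv_two_mul_sqrt_neg {x : ℝ} (hx : x < 0) :
    HasDerivAt (fun y : ℝ => 1 / (2 * √(-y))) (1 / (4 * √(-x) ^ 3)) x := by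
  have hs : 0 < √(-x) := Real.sqrt_pos.2 (by linarith)
  refine ((hasDerivAt_const x (1 : ℝ)).fun_div ((hasDerivAt_sqrt_neg hx).const_mul 2)
    (by positivity)).congr_deriv ?_
  field_simp
  ring

/-- If a solution `u` of `u'' = 2xu + 2u³` on `(-∞, ω)` with `u(x) - √(-x) → 0`
as `x → -∞` satisfies `u(x₀) > √(-x₀)` at some `x₀ < min(ω, 0)`, then
`u(x) > √(-x)` for all `x ∈ (x₀, min(ω, 0))`. -/
theorem PII_stays_above_sqrt (ω : EReal) (u u' u'' : ℝ → ℝ)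
    (hd1 : ∀ x : ℝ, (x : EReal) < ω → HasDerivAt u (u' x) x)
    (hd2 : ∀ x : ℝ, (x : EReal) < ω → HasDerivAt u' (u'' x) x)
    (hode : ∀ x : ℝ, (x : EReal) < ω → u'' x = 2 * x * u x + 2 * (u x) ^ 3)
    (hasymp : Tendsto (fun x : ℝ => u x - Real.sqrt (-x)) atBot (𝓝 0))
    (x₀ : ℝ) (hx₀ : (x₀ : EReal) < min ω 0)
    (hgt : Real.sqrt (-x₀) < u x₀) :
    ∀ x : ℝ, x₀ < x → (x : EReal) < min ω 0 → Real.sqrt (-x) < u x := by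
  intro x₁ hx₀₁ hx₁
  by_contra! hle
  obtain ⟨hω, h0⟩ := lt_min_iff.1 hx₁
  have hx₁neg : x₁ < 0 := by exact_mod_cast h0
  have hltω : ∀ x : ℝ, x ≤ x₁ → (x : EReal) < ω := fun x hx =>
    (EReal.coe_le_coe_iff.2 hx).trans_lt hω
  set w : ℝ → ℝ := fun x => u x - √(-x)
  have hw' : ∀ x : ℝ, x ≤ x₁ → HasDerivAt w (u' x + 1 / (2 * √(-x))) x := fun x hx =>
    ((hd1 x (hltω x hx)).fun_sub (hasDerivAt_sqrt_neg (hx.trans_lt hx₁neg))).congr_deriv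
      (sub_neg_eq_add _ _)
  have hwx₀ : 0 < w x₀ := sub_pos.2 hgt
  obtain ⟨M, hMw, hMx₀⟩ :=
    ((hasymp.eventually (gt_mem_nhds hwx₀)).and (eventually_lt_atBot x₀)).exists
  obtain ⟨p, hp, hpmax⟩ := isCompact_Icc.exists_isMaxOn
    (Set.nonempty_Icc.2 (hMx₀.trans hx₀₁).le)
    (fun x hx => (hw' x hx.2).continuousAt.continuousWithinAt)
  have hwp : w x₀ ≤ w p := hpmax ⟨hMx₀.le, hx₀₁.le⟩
  have hMp : M < p := hp.1.lt_of_ne fun h => by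
    subst h
    exact hMw.not_ge hwp
  have hpx₁ : p < x₁ := hp.2.lt_of_ne fun h => by
    subst h
    exact (hwx₀.trans_le hwp).not_ge (sub_nonpos.2 hle)
  have hpneg : p < 0 := hpx₁.trans hx₁neg
  have hloc : IsLocalMax w p := hpmax.isLocalMax (Icc_mem_nhds hMp hpx₁)
  have hnonpos := hloc.second_deriv_nonpos
    ((eventually_le_nhds hpx₁).mono fun x hx => hw' x hx)
    ((hd2 p (hltω p hpx₁.le)).fun_add (hasDerivAt_inv_two_mul_sqrt_neg hpneg))
  have hs : 0 < √(-p) := Real.sqrt_pos.2 (by linarith)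
  have hsq : √(-p) ^ 2 = -p := Real.sq_sqrt (by linarith)
  have hup : √(-p) < u p := sub_pos.1 (hwx₀.trans_le hwp)
  have hu : 0 < u p := hs.trans hup
  have hode' : u'' p = 2 * u p * ((u p - √(-p)) * (u p + √(-p))) := by
    rw [hode p (hltω p hpx₁.le)]
    linear_combination 2 * u p * hsq
  have hupos : 0 < u'' p := by
    rw [hode']
    have := sub_pos.2 hup
    positivity
  have : 0 < 1 / (4 * √(-p) ^ 3) := by positivity
  linarith
end

section
/- Let ω ∈ (−∞, +∞] and let u : (−∞, ω) → ℝ be twice differentiable with u''(x) = 2x·u(x) + 2u(x)³ for all x < ω. Assume that s ↦ u(s)² + s is absolutely integrable on (−∞, x] for every x < ω, that u'(x) → 0 and u(x)² + x → 0 as x → −∞, and that u'(x) < 0 for all sufficiently negative x. Let x_* ≤ ω be a real number such that u(x) > 0 and u(x)² + x < 0 for all x < x_*. Then u'(x) < u(x)² + x for all x < x_*. -/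
open Filter MeasureTheory Topology

/-- Let `u` solve `u'' = 2xu + 2u³` on `(-∞, ω)` with `u' → 0` and `u² + x → 0`
at `-∞`, `u' < 0` for all sufficiently negative `x`, and `s ↦ u(s)² + s`
absolutely integrable on `(-∞, x]` for every `x < ω`. If `x_* ≤ ω` is such that
`u(x) > 0` and `u(x)² + x < 0` for all `x < x_*`, then `u'(x) < u(x)² + x` for
all `x < x_*`. -/
theorem PII_deriv_bound (ω : EReal) (u u' u'' : ℝ → ℝ)
    (hd1 : ∀ x : ℝ, (x : EReal) < ω → HasDerivAt u (u' x) x)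
    (hd2 : ∀ x : ℝ, (x : EReal) < ω → HasDerivAt u' (u'' x) x)
    (hode : ∀ x : ℝ, (x : EReal) < ω → u'' x = 2 * x * u x + 2 * (u x) ^ 3)
    (hint : ∀ x : ℝ, (x : EReal) < ω →
      IntegrableOn (fun s : ℝ => (u s) ^ 2 + s) (Set.Iic x))
    (hlim1 : Tendsto u' atBot (𝓝 0))
    (hlim2 : Tendsto (fun x : ℝ => (u x) ^ 2 + x) atBot (𝓝 0))
    (hneg : ∀ᶠ x in atBot, u' x < 0)
    (xs : ℝ) (hxs : (xs : EReal) ≤ ω)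
    (hpos : ∀ x < xs, 0 < u x)
    (hreg : ∀ x < xs, (u x) ^ 2 + x < 0) :
    ∀ x < xs, u' x < (u x) ^ 2 + x := by
  have hω : ∀ x < xs, (x : EReal) < ω := fun x hx =>
    lt_of_lt_of_le (EReal.coe_lt_coe_iff.2 hx) hxs
  set f : ℝ → ℝ := fun x => u' x - ((u x) ^ 2 + x) with hf
  have hfd : ∀ x < xs, HasDerivAt f (-2 * u x * f x - 1) x := by
    intro x hx
    have h := (hd2 x (hω x hx)).sub (((hd1 x (hω x hx)).pow 2).add (hasDerivAt_id x))
    refine HasDerivAt.congr_deriv h ?_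
    rw [hode x (hω x hx)]
    simp only [hf]
    push_cast
    ring
  have hflim : Tendsto f atBot (𝓝 0) := by
    simpa using hlim1.sub hlim2
  have hle : ∀ x < xs, f x ≤ 0 := by
    intro x hx
    obtain ⟨a, ha1, hax⟩ :=
      ((hflim.eventually (gt_mem_nhds one_pos)).and (eventually_le_atBot (x - 2))).exists
    have hlt : ∀ y ∈ Set.Icc a x, y < xs := fun y hy => hy.2.trans_lt hx
    have hB : ∀ y : ℝ, HasDerivAt (fun y : ℝ => (x - y) / 2) (-1 / 2) y := fun y =>
      ((hasDerivAt_id y).const_sub x).div_const 2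
    have h := image_le_of_deriv_right_lt_deriv_boundary
      (fun y hy => (hfd y (hlt y hy)).continuousAt.continuousWithinAt)
      (fun y hy => (hfd y (hlt y ⟨hy.1, hy.2.le⟩)).hasDerivWithinAt)
      (show f a ≤ (x - a) / 2 by linarith) hB
      (fun y hy hfy => by
        have hu := hpos y (hlt y ⟨hy.1, hy.2.le⟩)
        have hf0 : 0 ≤ f y := by rw [hfy]; linarith [hy.2]
        nlinarith [mul_nonneg hu.le hf0])
      (Set.right_mem_Icc.2 (by linarith : a ≤ x))
    simpa using h
  intro x hx
  by_contra! hge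
  have hfx : f x = 0 := le_antisymm (hle x hx) (sub_nonneg.2 hge)
  have hmax : IsLocalMax f x := by
    filter_upwards [Iio_mem_nhds hx] with y hy
    exact (hle y hy).trans hfx.ge
  have h := hmax.hasDerivAt_eq_zero (hfd x hx)
  rw [hfx] at h
  norm_num at h
end

section
/- Let u₀ : ℝ → ℝ be twice differentiable with u₀''(x) = 2x·u₀(x) + 2u₀(x)³ for all x ∈ ℝ, and assume: u₀(x) > 0 for all x ∈ ℝ; u₀ is strictly decreasing on ℝ; u₀(x) − √(−x) → 0 and u₀'(x) → 0 as x → −∞; and s ↦ u₀(s)² + s is absolutely integrable on (−∞, x] for every x ∈ ℝ. Then u₀(x) > √(−x/3) for all x < 0. -/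
open Filter MeasureTheory Topology

/-- One-sided mean value inequality on a compact interval. -/
theorem sub_le_mul_sub_of_hasDerivAt_le {f f' : ℝ → ℝ} {a b C : ℝ} (hab : a ≤ b)
    (hf : ∀ x, HasDerivAt f (f' x) x) (hC : ∀ x ∈ Set.Icc a b, f' x ≤ C) :
    f b - f a ≤ C * (b - a) := by
  refine (convex_Icc a b).image_sub_le_mul_sub_of_deriv_le
    (fun x _ => (hf x).continuousAt.continuousWithinAt)
    (fun x _ => (hf x).differentiableAt.differentiableWithinAt) (fun x hx => ?_)
    a (Set.left_mem_Icc.2 hab) b (Set.right_mem_Icc.2 hab) hab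
  rw [(hf x).deriv]
  exact hC x (interior_subset hx)

/-- A function integrable near `-∞` takes arbitrarily small values arbitrarily far to the left. -/
theorem exists_le_abs_lt_of_integrableOn_Iic {g : ℝ → ℝ} {N ε : ℝ} (hε : 0 < ε)
    (hg : IntegrableOn g (Set.Iic N)) : ∃ x ≤ N, |g x| < ε := by
  by_contra! h
  have hc : IntegrableOn (fun _ : ℝ => ε) (Set.Iic N) := by
    refine Integrable.mono' hg.abs aestronglyMeasurable_const ?_
    filter_upwards [ae_restrict_mem measurableSet_Iic] with x hx
    rw [Real.norm_eq_abs, abs_of_pos hε]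
    exact h x hx
  rw [integrableOn_const_iff] at hc
  simp [hε.ne'] at hc

/-- The second derivative is nonpositive at a local maximum. -/
theorem IsLocalMax.nonpos_of_hasDerivAt_hasDerivAt {f f' : ℝ → ℝ} {f'' x : ℝ}
    (h : IsLocalMax f x) (hf : ∀ y, HasDerivAt f (f' y) y) (hf' : HasDerivAt f' f'' x) :
    f'' ≤ 0 := by
  by_contra! hpos
  have hderiv : deriv f = f' := funext fun y => (hf y).deriv
  have hmin : IsLocalMin f x := by
    refine isLocalMin_of_deriv_deriv_pos ?_ h.deriv_eq_zero (hf x).continuousAt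
    rwa [hderiv, hf'.deriv]
  have heq : f =ᶠ[𝓝 x] fun _ => f x := by
    filter_upwards [h, hmin] with y h₁ h₂ using le_antisymm h₁ h₂
  have h0 : deriv (deriv f) x = 0 := by
    rw [heq.deriv.deriv_eq]
    simp
  rw [hderiv, hf'.deriv] at h0
  exact hpos.ne' h0

/-- A function asymptotic to `√(-x)` at `-∞` makes `f² + x / 3` tend to `+∞` in both directions. -/
theorem tendsto_sq_add_div_three_cocompact {f : ℝ → ℝ}
    (hf : Tendsto (fun x : ℝ => f x - Real.sqrt (-x)) atBot (𝓝 0)) :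
    Tendsto (fun x => f x ^ 2 + x / 3) (cocompact ℝ) atTop := by
  rw [cocompact_eq_atBot_atTop, tendsto_sup]
  constructor
  · have hlin : Tendsto (fun x : ℝ => -x / 3 - 2) atBot atTop :=
      tendsto_atTop_add_const_right _ _
        (tendsto_neg_atBot_atTop.atTop_div_const (by norm_num))
    refine tendsto_atTop_mono' _ ?_ hlin
    filter_upwards [hf.eventually (lt_mem_nhds (show (-1 : ℝ) < 0 by norm_num)),
      eventually_le_atBot (-1 : ℝ)] with x hx hx1
    have hr : Real.sqrt (-x) ^ 2 = -x := Real.sq_sqrt (by linarith)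
    have hr1 : 1 ≤ Real.sqrt (-x) := Real.one_le_sqrt.2 (by linarith)
    have : (Real.sqrt (-x) - 1) ^ 2 ≤ f x ^ 2 :=
      pow_le_pow_left₀ (by linarith) (by linarith) 2
    nlinarith [sq_nonneg (Real.sqrt (-x) - 3)]
  · refine tendsto_atTop_mono (fun x => ?_)
      (tendsto_id.atTop_div_const (show (0 : ℝ) < 3 by norm_num))
    simpa using sq_nonneg (f x)

section PainleveII

variable {u u' u'' : ℝ → ℝ}

theorem hasDerivAt_sq_add_self (hd1 : ∀ x : ℝ, HasDerivAt u (u' x) x) (x : ℝ) :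
    HasDerivAt (fun s => u s ^ 2 + s) (2 * u x * u' x + 1) x := by
  refine HasDerivAt.congr_deriv (((hd1 x).pow 2).add (hasDerivAt_id x)) ?_
  push_cast
  ring

/-- Maximum principle: `u² + x` stays nonpositive to the left of a point where it is. -/
theorem sq_add_self_nonpos_of_le (hd1 : ∀ x : ℝ, HasDerivAt u (u' x) x)
    (hd2 : ∀ x : ℝ, HasDerivAt u' (u'' x) x)
    (hode : ∀ x : ℝ, u'' x = 2 * x * u x + 2 * (u x) ^ 3)
    (hpos : ∀ x : ℝ, 0 < u x)
    (hint : ∀ x : ℝ, IntegrableOn (fun s : ℝ => (u s) ^ 2 + s) (Set.Iic x))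
    {x₀ : ℝ} (hx₀ : u x₀ ^ 2 + x₀ ≤ 0) : ∀ x ≤ x₀, u x ^ 2 + x ≤ 0 := by
  intro c hc
  by_contra! hqc
  obtain ⟨b, hbc, hqb⟩ := exists_le_abs_lt_of_integrableOn_Iic hqc (hint c)
  have hcont : Continuous fun s => u s ^ 2 + s :=
    continuous_iff_continuousAt.2 fun x => (hasDerivAt_sq_add_self hd1 x).continuousAt
  obtain ⟨m, hm, hmax⟩ := isCompact_Icc.exists_isMaxOn
    (Set.nonempty_Icc.2 (hbc.trans hc)) (hcont.continuousOn (s := Set.Icc b x₀))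
  have hcm : u c ^ 2 + c ≤ u m ^ 2 + m := hmax ⟨hbc, hc⟩
  have hbm : b ≠ m := by
    rintro rfl
    exact absurd (lt_of_le_of_lt (le_abs_self _) hqb) (not_lt.2 hcm)
  have hmx : m ≠ x₀ := by
    rintro rfl
    linarith
  have hloc : IsLocalMax (fun s => u s ^ 2 + s) m :=
    hmax.isLocalMax (Icc_mem_nhds (lt_of_le_of_ne hm.1 hbm) (lt_of_le_of_ne hm.2 hmx))
  have h2 : HasDerivAt (fun x => 2 * u x * u' x + 1)
      (2 * u' m * u' m + 2 * u m * u'' m) m :=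
    (((hd1 m).const_mul 2).mul (hd2 m)).add_const 1
  have hle := hloc.nonpos_of_hasDerivAt_hasDerivAt (hasDerivAt_sq_add_self hd1) h2
  rw [hode m] at hle
  have : 0 < u m ^ 2 * (u m ^ 2 + m) := mul_pos (pow_pos (hpos m) 2) (by linarith)
  nlinarith [sq_nonneg (u' m)]

/-- The first-order quantity `u'² - (u² + x)²` has derivative `-2 (u² + x)`. -/
theorem hasDerivAt_deriv_sq_sub_sq (hd1 : ∀ x : ℝ, HasDerivAt u (u' x) x)
    (hd2 : ∀ x : ℝ, HasDerivAt u' (u'' x) x)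
    (hode : ∀ x : ℝ, u'' x = 2 * x * u x + 2 * (u x) ^ 3) (x : ℝ) :
    HasDerivAt (fun s => u' s ^ 2 - (u s ^ 2 + s) ^ 2) (-2 * (u x ^ 2 + x)) x := by
  refine HasDerivAt.congr_deriv (((hd2 x).pow 2).sub ((hasDerivAt_sq_add_self hd1 x).pow 2)) ?_
  rw [hode x]
  push_cast
  ring

/-- If `u² + x ≤ 0` on `(-∞, x₀]`, then `(u² + x)² ≤ u'²` there. -/
theorem sq_sq_add_self_le_deriv_sq (hd1 : ∀ x : ℝ, HasDerivAt u (u' x) x)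
    (hd2 : ∀ x : ℝ, HasDerivAt u' (u'' x) x)
    (hode : ∀ x : ℝ, u'' x = 2 * x * u x + 2 * (u x) ^ 3)
    (hint : ∀ x : ℝ, IntegrableOn (fun s : ℝ => (u s) ^ 2 + s) (Set.Iic x))
    {x₀ : ℝ} (hq : ∀ x ≤ x₀, u x ^ 2 + x ≤ 0) :
    (u x₀ ^ 2 + x₀) ^ 2 ≤ u' x₀ ^ 2 := by
  by_contra! hlt
  set d := (u x₀ ^ 2 + x₀) ^ 2 - u' x₀ ^ 2 with hd
  have hdpos : 0 < d := by linarith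
  obtain ⟨b, hb, hqb⟩ := exists_le_abs_lt_of_integrableOn_Iic (Real.sqrt_pos.2 hdpos) (hint x₀)
  have hqb2 : (u b ^ 2 + b) ^ 2 < d := by
    rw [← sq_abs, ← Real.sq_sqrt hdpos.le]
    exact pow_lt_pow_left₀ hqb (abs_nonneg _) two_ne_zero
  have hmono := sub_le_mul_sub_of_hasDerivAt_le (C := 0) hb
    (fun x => (hasDerivAt_deriv_sq_sub_sq hd1 hd2 hode x).neg)
    (fun x hx => by linarith [hq x hx.2])
  simp only [Pi.neg_apply] at hmono
  nlinarith [sq_nonneg (u' b)]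

/-- If `u² + x / 3` has a nonpositive value at a critical point, then `u` is small there. -/
theorem mul_pow_six_le_one_of_critical (hd1 : ∀ x : ℝ, HasDerivAt u (u' x) x)
    (hd2 : ∀ x : ℝ, HasDerivAt u' (u'' x) x)
    (hode : ∀ x : ℝ, u'' x = 2 * x * u x + 2 * (u x) ^ 3)
    (hpos : ∀ x : ℝ, 0 < u x)
    (hint : ∀ x : ℝ, IntegrableOn (fun s : ℝ => (u s) ^ 2 + s) (Set.Iic x))
    {x₀ : ℝ} (hx₀ : u x₀ ^ 2 + x₀ / 3 ≤ 0) (hcrit : 6 * u x₀ * u' x₀ = -1) :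
    3600 * u x₀ ^ 6 ≤ 1 := by
  have ha := hpos x₀
  have hq := sq_add_self_nonpos_of_le hd1 hd2 hode hpos hint (x₀ := x₀)
    (by nlinarith [pow_pos ha 2])
  have hconc : ∀ x ≤ x₀, u' x₀ ≤ u' x := by
    intro x hx
    have := sub_le_mul_sub_of_hasDerivAt_le (C := 0) hx hd2 (fun y hy => by
      rw [hode y]
      nlinarith [mul_nonneg (hpos y).le (neg_nonneg.2 (hq y hy.2))])
    linarith
  have htan : ∀ x ≤ x₀, u x ≤ u x₀ - u' x₀ * (x₀ - x) := by
    intro x hx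
    have := sub_le_mul_sub_of_hasDerivAt_le (C := -u' x₀) hx (fun y => (hd1 y).neg)
      (fun y hy => neg_le_neg (hconc y hy.2))
    simp only [Pi.neg_apply] at this
    linarith
  have hv2 : 36 * u x₀ ^ 2 * u' x₀ ^ 2 = 1 := by
    linear_combination (6 * u x₀ * u' x₀ - 1) * hcrit
  have hqle : ∀ x ∈ Set.Icc (x₀ - 24 * u x₀ ^ 2) x₀, u x ^ 2 + x ≤ -2 * u x₀ ^ 2 := by
    rintro x ⟨hx1, hx2⟩
    have hsq : u x ^ 2 ≤ (u x₀ - u' x₀ * (x₀ - x)) ^ 2 :=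
      pow_le_pow_left₀ (hpos x).le (htan x hx2) 2
    have hslope : u' x₀ ^ 2 * (x₀ - x) ≤ 2 / 3 := by
      nlinarith [mul_nonneg (sq_nonneg (u' x₀))
        (show 0 ≤ 24 * u x₀ ^ 2 - (x₀ - x) by linarith)]
    have hexp : (u x₀ - u' x₀ * (x₀ - x)) ^ 2
        = u x₀ ^ 2 + (x₀ - x) / 3 + u' x₀ ^ 2 * (x₀ - x) * (x₀ - x) := by
      linear_combination (-(x₀ - x) / 3) * hcrit
    have := mul_le_mul_of_nonneg_right hslope (show 0 ≤ x₀ - x by linarith)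
    linarith
  have hle : x₀ - 24 * u x₀ ^ 2 ≤ x₀ := by nlinarith [sq_nonneg (u x₀)]
  have hleft := sq_sq_add_self_le_deriv_sq hd1 hd2 hode hint
    (fun x hx => hq x (hx.trans hle))
  have hgain := sub_le_mul_sub_of_hasDerivAt_le (C := -4 * u x₀ ^ 2) hle
    (fun x => (hasDerivAt_deriv_sq_sub_sq hd1 hd2 hode x).neg)
    (fun x hx => by linarith [hqle x hx])
  simp only [Pi.neg_apply] at hgain
  have hq0 : (2 * u x₀ ^ 2) ^ 2 ≤ (-(u x₀ ^ 2 + x₀)) ^ 2 :=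
    pow_le_pow_left₀ (by positivity) (by linarith) 2
  have hv : 100 * u x₀ ^ 4 ≤ u' x₀ ^ 2 := by nlinarith
  nlinarith [mul_le_mul_of_nonneg_left hv (sq_nonneg (u x₀))]

end PainleveII

/-- The Hastings–McLeod solution `u₀` of `u'' = 2xu + 2u³` (positive, strictly
decreasing, asymptotic to `√(-x)` at `-∞`, with `u₀' → 0` at `-∞` and
`s ↦ u₀(s)² + s` absolutely integrable on `(-∞, x]` for every `x`) satisfies
`u₀(x) > √(-x/3)` for all `x < 0`. -/
theorem HastingsMcLeod_lower_bound (u₀ u₀' u₀'' : ℝ → ℝ)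
    (hd1 : ∀ x : ℝ, HasDerivAt u₀ (u₀' x) x)
    (hd2 : ∀ x : ℝ, HasDerivAt u₀' (u₀'' x) x)
    (hode : ∀ x : ℝ, u₀'' x = 2 * x * u₀ x + 2 * (u₀ x) ^ 3)
    (hpos : ∀ x : ℝ, 0 < u₀ x)
    (hanti : StrictAnti u₀)
    (hasymp : Tendsto (fun x : ℝ => u₀ x - Real.sqrt (-x)) atBot (𝓝 0))
    (hlim1 : Tendsto u₀' atBot (𝓝 0))
    (hint : ∀ x : ℝ, IntegrableOn (fun s : ℝ => (u₀ s) ^ 2 + s) (Set.Iic x)) :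
    ∀ x < (0 : ℝ), Real.sqrt (-x / 3) < u₀ x := by
  intro x hx
  by_contra! hle
  have hfx : u₀ x ^ 2 + x / 3 ≤ 0 := by
    have := pow_le_pow_left₀ (hpos x).le hle 2
    rw [Real.sq_sqrt (by linarith)] at this
    linarith
  have hderiv : ∀ y, HasDerivAt (fun s => u₀ s ^ 2 + s / 3) (2 * u₀ y * u₀' y + 1 / 3) y := by
    intro y
    refine HasDerivAt.congr_deriv (((hd1 y).pow 2).add ((hasDerivAt_id y).div_const 3)) ?_
    push_cast
    ring
  have hcont : Continuous fun s => u₀ s ^ 2 + s / 3 :=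
    continuous_iff_continuousAt.2 fun y => (hderiv y).continuousAt
  obtain ⟨x₀, hmin⟩ := hcont.exists_forall_le (tendsto_sq_add_div_three_cocompact hasymp)
  have hx₀ : u₀ x₀ ^ 2 + x₀ / 3 ≤ 0 := (hmin x).trans hfx
  have hloc : IsLocalMin (fun s => u₀ s ^ 2 + s / 3) x₀ := Eventually.of_forall hmin
  have hcrit : 6 * u₀ x₀ * u₀' x₀ = -1 := by
    linarith [hloc.hasDerivAt_eq_zero (hderiv x₀)]
  have hsmall := mul_pow_six_le_one_of_critical hd1 hd2 hode hpos hint hx₀ hcrit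
  have ha := hpos x₀
  set a := u₀ x₀ with ha_def
  have hacc : ∀ y ∈ Set.Icc x₀ (x₀ + 7 * a ^ 2), u₀'' y ≤ 10 * a ^ 3 := by
    rintro y ⟨hy1, hy2⟩
    have hya : u₀ y ≤ a := hanti.antitone hy1
    have hq : u₀ y ^ 2 + y ≤ 5 * a ^ 2 := by
      have := pow_le_pow_left₀ (hpos y).le hya 2
      linarith
    have h1 := mul_le_mul_of_nonneg_left hq (hpos y).le
    have h2 := mul_le_mul_of_nonneg_right hya (show 0 ≤ 5 * a ^ 2 by positivity)
    rw [hode y]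
    linarith
  have hslope : ∀ y ∈ Set.Icc x₀ (x₀ + 7 * a ^ 2), u₀' y ≤ u₀' x₀ + 70 * a ^ 5 := by
    rintro y ⟨hy1, hy2⟩
    have h1 := sub_le_mul_sub_of_hasDerivAt_le hy1 hd2
      (fun z hz => hacc z ⟨hz.1, hz.2.trans hy2⟩)
    have h2 := mul_le_mul_of_nonneg_left (show y - x₀ ≤ 7 * a ^ 2 by linarith)
      (show 0 ≤ 10 * a ^ 3 by positivity)
    linarith
  have hfin := sub_le_mul_sub_of_hasDerivAt_le
    (show x₀ ≤ x₀ + 7 * a ^ 2 by nlinarith [sq_nonneg a]) hd1 hslope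
  have hend := hpos (x₀ + 7 * a ^ 2)
  have hval : (u₀' x₀ + 70 * a ^ 5) * (x₀ + 7 * a ^ 2 - x₀) = a * (490 * a ^ 6 - 7 / 6) := by
    linear_combination (7 * a / 6) * hcrit
  rw [hval] at hfin
  nlinarith [mul_le_mul_of_nonneg_left hsmall ha.le]
end

section
/- Let ω ∈ (−∞, +∞], let x₀ < ω, and let u₁, u₂ : (−∞, ω) → ℝ be twice differentiable functions each satisfying u''(x) = 2x·u(x) + 2u(x)³ for all x < ω. Assume u₁(x₀) > u₂(x₀) and u₁'(x₀) > u₂'(x₀), that u₂(x) > √(−x/3) for all x ∈ [x₀, ω) with x < 0, and that u₂(x) ≥ 0 for all x ∈ [x₀, ω) with x ≥ 0. Then u₁(x) > u₂(x) for all x ∈ [x₀, ω). -/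
/-- A function that starts out positive and nondecreasing, and that is convex wherever it is
positive, stays positive. -/
theorem pos_of_second_deriv_nonneg_of_pos {w w' w'' : ℝ → ℝ} {a b : ℝ} (hab : a ≤ b)
    (hw : ∀ x ∈ Set.Icc a b, HasDerivAt w (w' x) x)
    (hw' : ∀ x ∈ Set.Icc a b, HasDerivAt w' (w'' x) x)
    (hconv : ∀ x ∈ Set.Icc a b, 0 < w x → 0 ≤ w'' x)
    (ha : 0 < w a) (ha' : 0 ≤ w' a) : 0 < w b := by
  by_contra! hb
  have hcont : ContinuousOn w (Set.Icc a b) := fun x hx =>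
    (hw x hx).continuousAt.continuousWithinAt
  have hcompact : IsCompact (Set.Icc a b ∩ w ⁻¹' Set.Iic 0) :=
    isCompact_Icc.of_isClosed_subset
      (hcont.preimage_isClosed_of_isClosed isClosed_Icc isClosed_Iic) Set.inter_subset_left
  obtain ⟨c, ⟨hc, hwc⟩, hmin⟩ := hcompact.exists_isLeast ⟨b, ⟨hab, le_rfl⟩, hb⟩
  have hsub : Set.Icc a c ⊆ Set.Icc a b := Set.Icc_subset_Icc_right hc.2
  have hpos : ∀ x ∈ Set.Ioo a c, 0 < w x := fun x hx => by
    by_contra! h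
    exact hx.2.not_ge (hmin ⟨hsub (Set.Ioo_subset_Icc_self hx), h⟩)
  have hmono' : MonotoneOn w' (Set.Icc a c) := by
    refine monotoneOn_of_hasDerivWithinAt_nonneg (f' := w'') (convex_Icc a c)
      (fun x hx => (hw' x (hsub hx)).continuousAt.continuousWithinAt) ?_ ?_ <;>
      intro x hx <;> rw [interior_Icc] at hx
    · exact (hw' x (hsub (Set.Ioo_subset_Icc_self hx))).hasDerivWithinAt
    · exact hconv x (hsub (Set.Ioo_subset_Icc_self hx)) (hpos x hx)
  have hmono : MonotoneOn w (Set.Icc a c) := by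
    refine monotoneOn_of_hasDerivWithinAt_nonneg (f' := w') (convex_Icc a c)
      (hcont.mono hsub) ?_ ?_ <;>
      intro x hx <;> rw [interior_Icc] at hx
    · exact (hw x (hsub (Set.Ioo_subset_Icc_self hx))).hasDerivWithinAt
    · exact ha'.trans
        (hmono' ⟨le_rfl, hc.1⟩ (Set.Ioo_subset_Icc_self hx) hx.1.le)
  exact (ha.trans_le (hmono ⟨le_rfl, hc.1⟩ ⟨hc.1, le_rfl⟩ hc.1)).not_ge hwc

/-- Comparison of two solutions of `u'' = 2xu + 2u³` on `(-∞, ω)`: if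
`u₁(x₀) > u₂(x₀)`, `u₁'(x₀) > u₂'(x₀)`, and `u₂(x) > √(-x/3)` for `x ∈ [x₀, ω)`
with `x < 0` while `u₂(x) ≥ 0` for `x ∈ [x₀, ω)` with `x ≥ 0`, then
`u₁(x) > u₂(x)` for all `x ∈ [x₀, ω)`. -/
theorem PII_comparison (ω : EReal) (x₀ : ℝ) (hx₀ : (x₀ : EReal) < ω)
    (u₁ u₁' u₁'' u₂ u₂' u₂'' : ℝ → ℝ)
    (h1d1 : ∀ x : ℝ, (x : EReal) < ω → HasDerivAt u₁ (u₁' x) x)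
    (h1d2 : ∀ x : ℝ, (x : EReal) < ω → HasDerivAt u₁' (u₁'' x) x)
    (h1ode : ∀ x : ℝ, (x : EReal) < ω → u₁'' x = 2 * x * u₁ x + 2 * (u₁ x) ^ 3)
    (h2d1 : ∀ x : ℝ, (x : EReal) < ω → HasDerivAt u₂ (u₂' x) x)
    (h2d2 : ∀ x : ℝ, (x : EReal) < ω → HasDerivAt u₂' (u₂'' x) x)
    (h2ode : ∀ x : ℝ, (x : EReal) < ω → u₂'' x = 2 * x * u₂ x + 2 * (u₂ x) ^ 3)
    (hval : u₂ x₀ < u₁ x₀) (hder : u₂' x₀ < u₁' x₀)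
    (hlow : ∀ x : ℝ, x₀ ≤ x → (x : EReal) < ω → x < 0 → Real.sqrt (-x / 3) < u₂ x)
    (hnonneg : ∀ x : ℝ, x₀ ≤ x → (x : EReal) < ω → 0 ≤ x → 0 ≤ u₂ x) :
    ∀ x : ℝ, x₀ ≤ x → (x : EReal) < ω → u₂ x < u₁ x := by
  intro b hb hbω
  have hlt : ∀ x ∈ Set.Icc x₀ b, (x : EReal) < ω := fun x hx =>
    (EReal.coe_le_coe_iff.2 hx.2).trans_lt hbω
  refine sub_pos.1 (pos_of_second_deriv_nonneg_of_pos (w := fun x => u₁ x - u₂ x)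
    (w' := fun x => u₁' x - u₂' x) (w'' := fun x => u₁'' x - u₂'' x) hb
    (fun x hx => (h1d1 x (hlt x hx)).sub (h2d1 x (hlt x hx)))
    (fun x hx => (h1d2 x (hlt x hx)).sub (h2d2 x (hlt x hx)))
    (fun x hx hwx => ?_) (sub_pos.2 hval) (sub_pos.2 hder).le)
  have hxω := hlt x hx
  have hbound : 0 ≤ u₂ x ∧ 0 ≤ x + 3 * u₂ x ^ 2 := by
    rcases lt_or_ge x 0 with hneg | hnn
    · have hsqrt := hlow x hx.1 hxω hneg
      have h2pos : 0 < u₂ x := (Real.sqrt_nonneg _).trans_lt hsqrt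
      have hsq := (Real.sqrt_lt' h2pos).1 hsqrt
      exact ⟨h2pos.le, by linarith⟩
    · exact ⟨hnonneg x hx.1 hxω hnn, by positivity⟩
  obtain ⟨h2, hx2⟩ := hbound
  have hfactor : u₁'' x - u₂'' x =
      2 * (u₁ x - u₂ x) * (x + u₁ x ^ 2 + u₁ x * u₂ x + u₂ x ^ 2) := by
    rw [h1ode x hxω, h2ode x hxω]
    ring
  change 0 ≤ u₁'' x - u₂'' x
  rw [hfactor]
  refine mul_nonneg (mul_nonneg zero_le_two hwx.le) ?_
  nlinarith [sub_pos.1 hwx]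
end

section
/- Fix σ ∈ ℝ and ε > 0. Let q : (−∞, σ) → ℝ be a real-analytic solution of the Painlevé II equation q''(x) = x·q(x) + 2q(x)³ such that q(x)/√(−x/2) → 1 as x → −∞, (x − σ)·q(x) → −1 as x ↑ σ (i.e. q has a simple pole at σ with residue −1), and q(x) > √(−x/6) for all x ≤ min(σ, 0). For each integer n ≥ 2 set t_n = n − 2^{−1/3}·σ·n^{1/3}, and let (a^{(n)}_k)_{k=0}^{n−2} ∈ (0,1)^{n−1} be the unique solution of the discrete Painlevé II equation a_{k+1} + a_{k−1} = ((k+ε)/t_n)·(2a_k/(1−a_k²)), k = 0,…,n−2, with a_{−1} = a_{n−1} = 1. Then for every x < 0 and every sequence of integers (k_n) with k_n/n^{1/3} → x, one has n^{1/3}·a^{(n)}_{n+k_n} → 2^{1/3}·q(2^{1/3}x + σ) as n → ∞. -/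
open Filter Topology

theorem painleveII_pos {σ : ℝ} {q q' q'' : ℝ → ℝ}
    (hd1 : ∀ x < σ, HasDerivAt q (q' x) x)
    (hd2 : ∀ x < σ, HasDerivAt q' (q'' x) x)
    (hode : ∀ x < σ, q'' x = x * q x + 2 * (q x) ^ 3)
    (hpole : Tendsto (fun x : ℝ => (x - σ) * q x) (𝓝[<] σ) (𝓝 (-1)))
    (hlow : ∀ x ≤ min σ 0, 0 < q x) :
    ∀ x < σ, 0 < q x := by
  intro x hx
  by_contra! hqx
  have hx0 : 0 < x := by
    by_contra! h
    exact absurd (hlow x (le_min hx.le h)) (not_lt.2 hqx)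
  obtain ⟨b, hb, hxb, hbσ⟩ : ∃ b, 0 < q b ∧ x < b ∧ b < σ := by
    have h1 : ∀ᶠ z in 𝓝[<] σ, (z - σ) * q z < 0 := hpole.eventually_lt_const (by norm_num)
    have h2 : ∀ᶠ z in 𝓝[<] σ, z ∈ Set.Ioo x σ := Ioo_mem_nhdsLT hx
    obtain ⟨b, h3, h4⟩ := (h1.and h2).exists
    exact ⟨b, by nlinarith [h4.2], h4.1, h4.2⟩
  have hcont : ContinuousOn q (Set.Icc 0 b) := fun z hz =>
    (hd1 z (hz.2.trans_lt hbσ)).continuousAt.continuousWithinAt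
  have hcont' : ContinuousOn q' (Set.Icc 0 b) := fun z hz =>
    (hd2 z (hz.2.trans_lt hbσ)).continuousAt.continuousWithinAt
  have h0 : 0 < q 0 := hlow 0 (le_min (hx0.trans hx).le le_rfl)
  obtain ⟨m, hm, hmin⟩ := isCompact_Icc.exists_isMinOn ⟨x, hx0.le, hxb.le⟩ hcont
  have hqm : q m ≤ 0 := (hmin ⟨hx0.le, hxb.le⟩).trans hqx
  have hm0 : 0 < m := hm.1.lt_of_ne (by rintro rfl; linarith)
  have hmb : m < b := hm.2.lt_of_ne (by rintro rfl; linarith)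
  have hq'm : q' m = 0 :=
    (hmin.isLocalMin (Icc_mem_nhds hm0 hmb)).hasDerivAt_eq_zero (hd1 m (hmb.trans hbσ))
  have hIσ : ∀ z ∈ Set.Icc m b, z < σ := fun z hz => hz.2.trans_lt hbσ
  have hsub : Set.Icc m b ⊆ Set.Icc 0 b := Set.Icc_subset_Icc_left hm0.le
  -- `q²` is nondecreasing to the right of its critical point `m`, so `q` vanishes there
  have hP : MonotoneOn (fun z => q z * q' z) (Set.Icc m b) := by
    refine monotoneOn_of_hasDerivWithinAt_nonneg (convex_Icc m b)
      ((hcont.mul hcont').mono hsub)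
      (fun z hz => (((hd1 z (hIσ z (interior_subset hz))).mul
        (hd2 z (hIσ z (interior_subset hz)))).hasDerivWithinAt)) fun z hz => ?_
    have hz' := interior_subset hz
    rw [hode z (hIσ z hz')]
    have : 0 ≤ z := hm0.le.trans hz'.1
    have e : q' z * q' z + q z * (z * q z + 2 * q z ^ 3)
      = q' z ^ 2 + z * q z ^ 2 + 2 * (q z ^ 2) ^ 2 := by ring
    rw [e]; positivity
  have hS : MonotoneOn (fun z => q z * q z) (Set.Icc m b) := by
    refine monotoneOn_of_hasDerivWithinAt_nonneg (convex_Icc m b)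
      ((hcont.mul hcont).mono hsub)
      (fun z hz => (((hd1 z (hIσ z (interior_subset hz))).mul
        (hd1 z (hIσ z (interior_subset hz)))).hasDerivWithinAt)) fun z hz => ?_
    have hz' := interior_subset hz
    have := hP ⟨le_rfl, hmb.le⟩ hz' hz'.1
    simp only [hq'm, mul_zero] at this
    linarith
  have hqm0 : q m = 0 := by
    obtain ⟨z, hz, hz0⟩ := intermediate_value_Icc hmb.le (hcont.mono hsub) ⟨hqm, hb.le⟩
    have := hS ⟨le_rfl, hmb.le⟩ hz hz.1
    simp only [hz0, mul_zero] at this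
    nlinarith [mul_self_nonneg (q m)]
  obtain ⟨B, hB⟩ := isCompact_Icc.exists_bound_of_continuousOn (hcont.mono hsub)
  have hE := eq_zero_of_abs_deriv_le_mul_abs_self_of_eq_zero_right
    (f := fun z => q z * q z + q' z * q' z) (a := m) (b := b) (K := 1 + b + 2 * B ^ 2)
    (f' := fun z => q' z * q z + q z * q' z + (q'' z * q' z + q' z * q'' z))
    (((hcont.mul hcont).add (hcont'.mul hcont')).mono hsub)
    (fun z hz => by
      have hz' := hIσ z (Set.Ico_subset_Icc_self hz)
      exact (((hd1 z hz').mul (hd1 z hz')).add ((hd2 z hz').mul (hd2 z hz'))).hasDerivWithinAt)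
    (by simp [hqm0, hq'm])
    (fun z hz => by
      have hz' := Set.Ico_subset_Icc_self hz
      have hBz := hB z hz'
      rw [Real.norm_eq_abs] at hBz
      have hB2 : q z ^ 2 ≤ B ^ 2 := sq_le_sq' (by linarith [neg_abs_le (q z)])
        (by linarith [le_abs_self (q z)])
      have hzb := hz'.2
      have hz0 : 0 ≤ z := hm0.le.trans hz'.1
      rw [hode z (hIσ z hz'), Real.norm_eq_abs, Real.norm_eq_abs]
      have e : q' z * q z + q z * q' z + ((z * q z + 2 * q z ^ 3) * q' z
        + q' z * (z * q z + 2 * q z ^ 3)) = 2 * (q z * q' z) * (1 + z + 2 * q z ^ 2) := by ring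
      have hnn : 0 ≤ q z * q z + q' z * q' z :=
        add_nonneg (mul_self_nonneg _) (mul_self_nonneg _)
      have h1 : |2 * (q z * q' z)| ≤ q z * q z + q' z * q' z :=
        abs_le.2 ⟨by nlinarith [sq_nonneg (q z + q' z)], by nlinarith [sq_nonneg (q z - q' z)]⟩
      have h2 : |1 + z + 2 * q z ^ 2| ≤ 1 + b + 2 * B ^ 2 := by
        rw [abs_of_nonneg (by positivity)]; linarith
      rw [e, abs_mul, abs_of_nonneg hnn, mul_comm (1 + b + 2 * B ^ 2)]
      exact mul_le_mul h1 h2 (abs_nonneg _) hnn) b ⟨hmb.le, le_rfl⟩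
  nlinarith [mul_pos hb hb, mul_self_nonneg (q' b)]

theorem exists_pos_bounds_of_tendsto_cocompact {f : ℝ → ℝ} (hf : Continuous f)
    (hpos : ∀ x, 0 < f x) (hlim : Tendsto f (cocompact ℝ) (𝓝 1)) :
    ∃ m > 0, ∃ M, ∀ x, m ≤ f x ∧ f x ≤ M := by
  have hlog : Tendsto (fun x => Real.log (f x)) (cocompact ℝ) (𝓝 0) := by
    simpa using hlim.log one_ne_zero
  obtain ⟨B, hB⟩ := (ZeroAtInftyContinuousMap.isBounded_range
    (⟨⟨fun x => Real.log (f x), hf.log fun x => (hpos x).ne'⟩, hlog⟩ :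
      ZeroAtInftyContinuousMap ℝ ℝ)).exists_norm_le
  refine ⟨Real.exp (-B), Real.exp_pos _, Real.exp B, fun x => ?_⟩
  have h : |Real.log (f x)| ≤ B := hB _ ⟨x, rfl⟩
  rw [← Real.le_log_iff_exp_le (hpos x), ← Real.log_le_iff_le_exp (hpos x)]
  exact abs_le.1 h

theorem profile_tendsto_atTop {U : ℝ → ℝ}
    (hinf : Tendsto (fun y => U y / √y) atTop (𝓝 1)) :
    Tendsto (fun y => U y / (1 / y + √y)) atTop (𝓝 1) := by
  have h1 : Tendsto (fun y : ℝ => 1 + (y * √y)⁻¹) atTop (𝓝 (1 + 0)) :=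
    tendsto_const_nhds.add (tendsto_id.atTop_mul_atTop₀ Real.tendsto_sqrt_atTop).inv_tendsto_atTop
  have h2 := hinf.div h1 (by norm_num)
  rw [add_zero, div_one] at h2
  refine h2.congr' ?_
  filter_upwards [eventually_gt_atTop 0] with y hy
  have : 0 < √y := Real.sqrt_pos.2 hy
  simp only [Pi.div_apply]
  field_simp
  ring

theorem profile_tendsto_zero {U : ℝ → ℝ}
    (h0 : Tendsto (fun y => y * U y) (𝓝[>] 0) (𝓝 1)) :
    Tendsto (fun y => U y / (1 / y + √y)) (𝓝[>] 0) (𝓝 1) := by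
  have h1 : Tendsto (fun y : ℝ => 1 + y * √y) (𝓝[>] 0) (𝓝 1) := by
    have : ContinuousAt (fun y : ℝ => 1 + y * √y) 0 := by fun_prop
    simpa [ContinuousAt] using this.tendsto.mono_left nhdsWithin_le_nhds
  have h2 := h0.div h1 (by norm_num)
  rw [div_one] at h2
  refine h2.congr' ?_
  filter_upwards [self_mem_nhdsWithin] with y hy
  have hy' : 0 < y := hy
  have : 0 < √y := Real.sqrt_pos.2 hy
  simp only [Pi.div_apply]
  field_simp

theorem profile_ratio_exp {U : ℝ → ℝ} (hcont : ContinuousOn U (Set.Ioi 0))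
    (h0 : Tendsto (fun y => y * U y) (𝓝[>] 0) (𝓝 1))
    (hinf : Tendsto (fun y => U y / √y) atTop (𝓝 1)) :
    Continuous (fun v => U (Real.exp v) / (1 / Real.exp v + √(Real.exp v))) ∧
    Tendsto (fun v => U (Real.exp v) / (1 / Real.exp v + √(Real.exp v)))
      (cocompact ℝ) (𝓝 1) := by
  constructor
  · have h1 : Continuous fun v => U (Real.exp v) :=
      hcont.comp_continuous Real.continuous_exp fun v => Real.exp_pos v
    refine h1.div₀ ?_ fun v => by positivity
    exact (continuous_const.div Real.continuous_exp fun v => (Real.exp_pos v).ne').add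
      Real.continuous_exp.sqrt
  · rw [cocompact_eq_atBot_atTop]
    exact ((profile_tendsto_zero h0).comp Real.tendsto_exp_atBot_nhdsGT).sup
      ((profile_tendsto_atTop hinf).comp Real.tendsto_exp_atTop)

theorem profile_bounds {U : ℝ → ℝ} (hpos : ∀ y > 0, 0 < U y)
    (hcont : ContinuousOn U (Set.Ioi 0))
    (h0 : Tendsto (fun y => y * U y) (𝓝[>] 0) (𝓝 1))
    (hinf : Tendsto (fun y => U y / √y) atTop (𝓝 1)) :
    ∃ C > 0, ∀ y > 0, y ≤ C * U y ^ 2 ∧ 1 ≤ C * U y ^ 2 ∧ U y ^ 2 ≤ C * (y + 1 / y ^ 2) := by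
  obtain ⟨hc, hl⟩ := profile_ratio_exp hcont h0 hinf
  obtain ⟨m, hm, M, hmM⟩ := exists_pos_bounds_of_tendsto_cocompact hc
    (fun v => div_pos (hpos _ (Real.exp_pos v)) (by positivity)) hl
  have hM : 0 < M := hm.trans_le ((hmM 0).1.trans (hmM 0).2)
  refine ⟨1 / m ^ 2 + 2 * M ^ 2, by positivity, fun y hy => ?_⟩
  have hs : 0 < √y := Real.sqrt_pos.2 hy
  have hss : √y ^ 2 = y := Real.sq_sqrt hy.le
  have h := hmM (Real.log y)
  rw [Real.exp_log hy] at h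
  have hp : 0 < 1 / y + √y := by positivity
  rw [le_div_iff₀ hp, div_le_iff₀ hp] at h
  have hU := hpos y hy
  have hlow : (1 / y + √y) ^ 2 ≤ 1 / m ^ 2 * U y ^ 2 := by
    rw [div_mul_eq_mul_div, one_mul, le_div_iff₀ (by positivity), ← mul_pow]
    exact pow_le_pow_left₀ (by positivity) (by linarith [h.1]) 2
  have hupp : U y ^ 2 ≤ M ^ 2 * (1 / y + √y) ^ 2 := by
    rw [← mul_pow]
    exact pow_le_pow_left₀ hU.le h.2 2
  have hy' : 0 < 1 / y := by positivity
  have hM2 : 0 ≤ 2 * M ^ 2 * U y ^ 2 := by positivity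
  have hm2 : 0 ≤ 1 / m ^ 2 * (y + 1 / y ^ 2) := by positivity
  have e : (1 / y) ^ 2 = 1 / y ^ 2 := by ring
  have hp1 : 1 ≤ (1 / y + √y) ^ 2 := by
    apply one_le_pow₀
    rcases le_total y 1 with h1 | h1
    · have := one_le_one_div hy h1
      linarith
    · have := Real.one_le_sqrt.2 h1
      linarith
  refine ⟨by nlinarith, by nlinarith, ?_⟩
  have : (1 / y + √y) ^ 2 ≤ 2 * (y + 1 / y ^ 2) := by nlinarith [sq_nonneg (1 / y - √y)]
  nlinarith [mul_le_mul_of_nonneg_left this (sq_nonneg M)]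

theorem inv_add_sqrt_bounds {y ξ κ : ℝ} (hy : 0 < y) (hκ : 0 < κ) (hκ1 : κ ≤ 1)
    (hξ : |ξ - y| ≤ κ / 8 * y) :
    (1 - κ / 4) * (1 / y + √y) ≤ 1 / ξ + √ξ ∧
      1 / ξ + √ξ ≤ (1 + κ / 4) * (1 / y + √y) := by
  obtain ⟨hξ1, hξ2⟩ := abs_le.1 hξ
  have hξ1' : (1 - κ / 8) * y ≤ ξ := by linarith
  have hξ2' : ξ ≤ (1 + κ / 8) * y := by linarith
  have hξ0 : 0 < ξ := lt_of_lt_of_le (mul_pos (by linarith) hy) hξ1'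
  rw [mul_add, mul_add]
  refine ⟨add_le_add ?_ ?_, add_le_add ?_ ?_⟩
  · rw [mul_one_div, div_le_div_iff₀ hy hξ0]
    have := mul_le_mul_of_nonneg_left hξ2' (show 0 ≤ 1 - κ / 4 by linarith)
    nlinarith [mul_pos hκ hy, mul_pos (mul_pos hκ hκ) hy]
  · apply Real.le_sqrt_of_sq_le
    rw [mul_pow, Real.sq_sqrt hy.le]
    exact (mul_le_mul_of_nonneg_right (by nlinarith) hy.le).trans hξ1'
  · rw [mul_one_div, div_le_div_iff₀ hξ0 hy]
    have := mul_le_mul_of_nonneg_left hξ1' (show 0 ≤ 1 + κ / 4 by linarith)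
    nlinarith [mul_pos hκ hy, mul_nonneg (mul_nonneg hκ.le (sub_nonneg.2 hκ1)) hy.le]
  · rw [Real.sqrt_le_left (by positivity), mul_pow, Real.sq_sqrt hy.le]
    exact hξ2'.trans (mul_le_mul_of_nonneg_right (by nlinarith) hy.le)

theorem profile_slowly_varying {U : ℝ → ℝ} (hpos : ∀ y > 0, 0 < U y)
    (hcont : ContinuousOn U (Set.Ioi 0))
    (h0 : Tendsto (fun y => y * U y) (𝓝[>] 0) (𝓝 1))
    (hinf : Tendsto (fun y => U y / √y) atTop (𝓝 1)) {η : ℝ} (hη : 0 < η) :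
    ∃ τ > 0, τ < 1 ∧ ∀ y > 0, ∀ ξ, |ξ - y| ≤ τ * y → |U ξ - U y| ≤ η * U y := by
  obtain ⟨hc, hl⟩ := profile_ratio_exp hcont h0 hinf
  obtain ⟨m, hm, M, hmM⟩ := exists_pos_bounds_of_tendsto_cocompact hc
    (fun v => div_pos (hpos _ (Real.exp_pos v)) (by positivity)) hl
  have huc := hc.uniformContinuous_of_tendsto_cocompact hl
  set κ := min η 1 with hκ
  have hκ0 : 0 < κ := lt_min hη one_pos
  have hκ1 : κ ≤ 1 := min_le_right _ _
  obtain ⟨δ, hδ, hδφ⟩ := Metric.uniformContinuous_iff.1 huc (κ / 4 * m) (by positivity)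
  obtain ⟨τ₀, hτ₀, hlog⟩ := Metric.continuousAt_iff.1
    (Real.continuousAt_log one_ne_zero) δ hδ
  refine ⟨min (τ₀ / 2) (κ / 8), by positivity, (min_le_right _ _).trans_lt (by linarith),
    fun y hy ξ hξ => ?_⟩
  set τ := min (τ₀ / 2) (κ / 8) with hτ
  have hτ1 : τ ≤ κ / 8 := min_le_right _ _
  have hτ2 : τ ≤ τ₀ / 2 := min_le_left _ _
  have hτ0 : 0 < τ := by positivity
  obtain ⟨hξ1, hξ2⟩ := abs_le.1 hξ
  have hξ1' : (1 - τ) * y ≤ ξ := by linarith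
  have hξ2' : ξ ≤ (1 + τ) * y := by linarith
  have hξ0 : 0 < ξ := lt_of_lt_of_le (mul_pos (by linarith) hy) hξ1'
  have hφ : |U ξ / (1 / ξ + √ξ) - U y / (1 / y + √y)| ≤ κ / 4 * m := by
    have h1 : dist (ξ / y) 1 < τ₀ := by
      rw [Real.dist_eq, div_sub_one hy.ne', abs_div, abs_of_pos hy, div_lt_iff₀ hy]
      exact hξ.trans_lt (mul_lt_mul_of_pos_right (by linarith) hy)
    have h2 := hlog h1
    rw [Real.log_one, Real.log_div hξ0.ne' hy.ne', dist_zero_right, ← dist_eq_norm] at h2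
    have h3 := hδφ h2
    rw [Real.exp_log hξ0, Real.exp_log hy, Real.dist_eq] at h3
    exact h3.le
  have hmy := (hmM (Real.log y)).1
  rw [Real.exp_log hy] at hmy
  have hp : 0 < 1 / y + √y := by positivity
  have hpξ : 0 < 1 / ξ + √ξ := by positivity
  set φ := U y / (1 / y + √y) with hφdef
  set ψ := U ξ / (1 / ξ + √ξ) with hψdef
  have hUy : U y = φ * (1 / y + √y) := by rw [hφdef, div_mul_cancel₀ _ hp.ne']
  have hUξ : U ξ = ψ * (1 / ξ + √ξ) := by rw [hψdef, div_mul_cancel₀ _ hpξ.ne']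
  obtain ⟨hp2, hp1⟩ := inv_add_sqrt_bounds hy hκ0 hκ1
    (hξ.trans (mul_le_mul_of_nonneg_right hτ1 hy.le))
  obtain ⟨hφ1, hφ2⟩ := abs_le.1 hφ
  have hφ0 : 0 < φ := hm.trans_le hmy
  have hκφ : κ / 4 * m ≤ κ / 4 * φ := mul_le_mul_of_nonneg_left hmy (by positivity)
  have hψ1 : ψ ≤ (1 + κ / 4) * φ := by linarith
  have hψ2 : (1 - κ / 4) * φ ≤ ψ := by linarith
  have hψ0 : 0 < ψ := lt_of_lt_of_le (mul_pos (by linarith) hφ0) hψ2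
  have hU0 := hpos y hy
  have hup : U ξ ≤ (1 + κ / 4) * (1 + κ / 4) * U y := by
    rw [hUξ, hUy]
    calc ψ * (1 / ξ + √ξ) ≤ ((1 + κ / 4) * φ) * ((1 + κ / 4) * (1 / y + √y)) := by gcongr
      _ = _ := by ring
  have hdn : (1 - κ / 4) * (1 - κ / 4) * U y ≤ U ξ := by
    rw [hUξ, hUy]
    have : 0 ≤ 1 - κ / 4 := by linarith
    calc _ = ((1 - κ / 4) * φ) * ((1 - κ / 4) * (1 / y + √y)) := by ring
      _ ≤ ψ * (1 / ξ + √ξ) := by gcongr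
  have hle : κ * U y ≤ η * U y := mul_le_mul_of_nonneg_right (min_le_left _ _) hU0.le
  have hc1 : (1 + κ / 4) * (1 + κ / 4) ≤ 1 + κ := by nlinarith
  have hc2 : 1 - κ ≤ (1 - κ / 4) * (1 - κ / 4) := by nlinarith
  have h1 := mul_le_mul_of_nonneg_right hc1 hU0.le
  have h2 := mul_le_mul_of_nonneg_right hc2 hU0.le
  rw [abs_le]
  constructor <;> linarith

theorem abs_second_difference_sub_le {f f' f'' : ℝ → ℝ} {y h M : ℝ} (hh : 0 ≤ h)
    (hf : ∀ ξ, |ξ - y| ≤ h → HasDerivAt f (f' ξ) ξ)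
    (hf' : ∀ ξ, |ξ - y| ≤ h → HasDerivAt f' (f'' ξ) ξ)
    (hM : ∀ ξ, |ξ - y| ≤ h → |f'' ξ - f'' y| ≤ M) :
    |f (y + h) + f (y - h) - 2 * f y - h ^ 2 * f'' y| ≤ 2 * M * h ^ 2 := by
  have hM0 : 0 ≤ M := by simpa using hM y (by simpa using hh)
  have key : ∀ s ∈ Set.Icc 0 h, |f' (y + s) - f' (y - s) - 2 * s * f'' y| ≤ M * (2 * s) := by
    intro s hs
    have hk := Convex.norm_image_sub_le_of_norm_hasDerivWithin_le (𝕜 := ℝ)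
      (f := fun r => f' r - r * f'' y) (f' := fun r => f'' r - 1 * f'' y)
      (s := Set.Icc (y - h) (y + h)) (x := y - s) (y := y + s) (C := M)
      (fun r hr => ((hf' r (abs_le.2 ⟨by linarith [hr.1], by linarith [hr.2]⟩)).sub
        ((hasDerivAt_id r).mul_const _)).hasDerivWithinAt)
      (fun r hr => by
        simpa using hM r (abs_le.2 ⟨by linarith [hr.1], by linarith [hr.2]⟩))
      (convex_Icc _ _) ⟨by linarith [hs.2], by linarith [hs.1]⟩
      ⟨by linarith [hs.1], by linarith [hs.2]⟩
    rw [Real.norm_eq_abs, Real.norm_eq_abs] at hk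
    have e1 : f' (y + s) - (y + s) * f'' y - (f' (y - s) - (y - s) * f'' y)
      = f' (y + s) - f' (y - s) - 2 * s * f'' y := by ring
    have e2 : |y + s - (y - s)| = 2 * s := by
      rw [abs_of_nonneg] <;> linarith [hs.1]
    rwa [e1, e2] at hk
  have hH := Convex.norm_image_sub_le_of_norm_hasDerivWithin_le (𝕜 := ℝ)
    (f := fun s => f (y + s) + f (y - s) - s ^ 2 * f'' y)
    (f' := fun s => f' (y + s) - f' (y - s) - 2 * s * f'' y)
    (s := Set.Icc 0 h) (x := 0) (y := h) (C := M * (2 * h))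
    (fun s hs => by
      have h1 := (hf (y + s) (by simpa [abs_of_nonneg hs.1] using hs.2)).comp_const_add y s
      have h2 := (hf (y - s) (by simpa [abs_of_nonneg hs.1] using hs.2)).comp_const_sub y s
      have h3 := ((hasDerivAt_pow 2 s).mul_const (f'' y))
      exact ((h1.add h2).sub h3).hasDerivWithinAt.congr_deriv (by simp; ring))
    (fun s hs => (key s hs).trans (by nlinarith [hs.2]))
    (convex_Icc _ _) ⟨le_rfl, hh⟩ ⟨hh, le_rfl⟩
  rw [Real.norm_eq_abs, Real.norm_eq_abs, sub_zero h, abs_of_nonneg hh] at hH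
  have e : f (y + h) + f (y - h) - h ^ 2 * f'' y - (f (y + 0) + f (y - 0) - 0 ^ 2 * f'' y)
    = f (y + h) + f (y - h) - 2 * f y - h ^ 2 * f'' y := by simp; ring
  rw [e] at hH
  linarith

/-- Pointwise variation of the right-hand side `2 (κ - y) u + 2 u³` of the rescaled equation. -/
theorem abs_painleve_rhs_sub_le {κ y ξ u v C η : ℝ} (hy : 0 < y) (hu : 0 < u) (hC : 0 < C)
    (hη : η ≤ 1) (hyC : y ≤ C * u ^ 2) (h1C : 1 ≤ C * u ^ 2)
    (hξ : |ξ - y| ≤ η * y) (hv : |v - u| ≤ η * u) :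
    |(2 * (κ - ξ) * v + 2 * v ^ 3) - (2 * (κ - y) * u + 2 * u ^ 3)|
      ≤ (2 * (|κ| + 1) * C + 4 * C + 14) * η * u ^ 3 := by
  have hη0 : 0 ≤ η := by
    by_contra! h
    have := (abs_nonneg _).trans hv
    nlinarith
  obtain ⟨hv1, hv2⟩ := abs_le.1 hv
  have hv0 : 0 ≤ v := by nlinarith
  have hvu : v ≤ 2 * u := by nlinarith
  have hκy : |κ - y| ≤ (|κ| + 1) * C * u ^ 2 := by
    have := abs_sub κ y
    rw [abs_of_pos hy] at this
    nlinarith [abs_nonneg κ]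
  have e : (2 * (κ - ξ) * v + 2 * v ^ 3) - (2 * (κ - y) * u + 2 * u ^ 3)
    = 2 * ((κ - y) * (v - u)) + 2 * ((y - ξ) * v) + 2 * ((v - u) * (v ^ 2 + v * u + u ^ 2)) := by
    ring
  have t1 : |(κ - y) * (v - u)| ≤ ((|κ| + 1) * C * u ^ 2) * (η * u) := by
    rw [abs_mul]
    exact mul_le_mul hκy hv (abs_nonneg _) (by positivity)
  have t2 : |(y - ξ) * v| ≤ (η * (C * u ^ 2)) * (2 * u) := by
    rw [abs_mul, abs_sub_comm, abs_of_nonneg hv0]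
    exact mul_le_mul (hξ.trans (mul_le_mul_of_nonneg_left hyC hη0)) hvu hv0 (by positivity)
  have t3 : |(v - u) * (v ^ 2 + v * u + u ^ 2)| ≤ (η * u) * (7 * u ^ 2) := by
    rw [abs_mul, abs_of_nonneg (by positivity : 0 ≤ v ^ 2 + v * u + u ^ 2)]
    exact mul_le_mul hv (by nlinarith) (by positivity) (by positivity)
  rw [e]
  refine (abs_add_three _ _ _).trans ?_
  rw [abs_mul 2, abs_mul 2, abs_mul 2, abs_two]
  nlinarith

/-- `U` is a positive solution on `(0, ∞)` of `u'' = 2 (κ - y) u + 2 u³` with `y U(y) → 1` at `0`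
and `U(y) / √y → 1` at infinity. -/
structure IsPoleSolution (κ : ℝ) (U U' : ℝ → ℝ) : Prop where
  pos : ∀ y > 0, 0 < U y
  hasDerivAt : ∀ y > 0, HasDerivAt U (U' y) y
  hasDerivAt' : ∀ y > 0, HasDerivAt U' (2 * (κ - y) * U y + 2 * U y ^ 3) y
  tendsto_zero : Tendsto (fun y => y * U y) (𝓝[>] 0) (𝓝 1)
  tendsto_atTop : Tendsto (fun y => U y / √y) atTop (𝓝 1)

namespace IsPoleSolution

variable {κ : ℝ} {U U' : ℝ → ℝ}

theorem continuousOn (hU : IsPoleSolution κ U U') : ContinuousOn U (Set.Ioi 0) :=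
  fun y hy => (hU.hasDerivAt y hy).continuousAt.continuousWithinAt

theorem abs_sq_sub_le (hU : IsPoleSolution κ U U') {η : ℝ} (hη : 0 < η) :
    ∃ J > 0, ∃ h₀ > 0, ∀ h, 0 < h → h < h₀ → ∀ y, J * h ≤ y → y * h ^ 2 ≤ 1 →
      |(h * U y) ^ 2 - y * h ^ 2| ≤ η := by
  obtain ⟨C, hC, hCU⟩ := profile_bounds hU.pos hU.continuousOn hU.tendsto_zero hU.tendsto_atTop
  have hsq : Tendsto (fun y => (U y / √y) ^ 2) atTop (𝓝 1) := by
    simpa using hU.tendsto_atTop.pow 2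
  obtain ⟨M, hM⟩ := eventually_atTop.1
    ((Metric.tendsto_nhds.1 hsq η hη).and (eventually_ge_atTop 1))
  have hM1 : 1 ≤ M := (hM M le_rfl).2
  refine ⟨2 * C / η + 1, by positivity, min 1 (η / (2 * ((C + 1) * M))), by positivity,
    fun h hh hh₀ y hy hyh => ?_⟩
  have hJ : 0 < 2 * C / η + 1 := by positivity
  have hy0 : 0 < y := (mul_pos hJ hh).trans_le hy
  have e : (h * U y) ^ 2 - y * h ^ 2 = h ^ 2 * (U y ^ 2 - y) := by ring
  rw [e, abs_mul, abs_of_nonneg (sq_nonneg h)]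
  rcases le_or_gt M y with hMy | hMy
  · have h1 := (hM y hMy).1
    rw [Real.dist_eq, div_pow, Real.sq_sqrt hy0.le, div_sub_one hy0.ne', abs_div,
      abs_of_pos hy0, div_lt_iff₀ hy0] at h1
    nlinarith [mul_le_mul_of_nonneg_left h1.le (sq_nonneg h),
      mul_le_mul_of_nonneg_left hyh hη.le]
  · have h1 : |U y ^ 2 - y| ≤ (C + 1) * M + C * (1 / y ^ 2) := by
      have h2 := (hCU y hy0).2.2
      rw [abs_le]
      constructor <;> nlinarith [sq_nonneg (U y), mul_pos hC (show 0 < 1 / y ^ 2 by positivity)]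
    have hh1 : h < 1 := hh₀.trans_le (min_le_left _ _)
    have hh2 : h * (2 * ((C + 1) * M)) ≤ η :=
      (le_div_iff₀ (by positivity)).1 (hh₀.le.trans (min_le_right _ _))
    have h3 : h ^ 2 * ((C + 1) * M) ≤ η / 2 := by
      have : h ^ 2 ≤ h := by nlinarith
      nlinarith [mul_le_mul_of_nonneg_right this (show 0 ≤ (C + 1) * M by positivity)]
    have h4 : h ^ 2 * (C * (1 / y ^ 2)) ≤ η / 2 := by
      have h5 : (2 * C / η) * h ^ 2 ≤ y ^ 2 := by
        have h6 : ((2 * C / η + 1) * h) ^ 2 ≤ y ^ 2 := pow_le_pow_left₀ (by positivity) hy 2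
        have h7 : 0 < 2 * C / η := by positivity
        rw [mul_pow] at h6
        refine le_trans (mul_le_mul_of_nonneg_right ?_ (sq_nonneg h)) h6
        nlinarith
      have h8 : 2 * C * h ^ 2 ≤ η * y ^ 2 := by
        rw [div_mul_eq_mul_div, div_le_iff₀ hη] at h5
        linarith
      rw [mul_one_div, mul_div_assoc', div_le_iff₀ (by positivity)]
      linarith
    calc h ^ 2 * |U y ^ 2 - y| ≤ h ^ 2 * ((C + 1) * M + C * (1 / y ^ 2)) :=
          mul_le_mul_of_nonneg_left h1 (sq_nonneg h)
      _ ≤ η := by rw [mul_add]; linarith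

end IsPoleSolution

theorem abs_discrete_residual_le {b s c K Y η lam : ℝ} (hb : 0 < b)
    (hs : |s - 2 * b * (1 + (K - Y) + b ^ 2)| ≤ η * b ^ 3)
    (hc : |c - 1 - (K - Y)| ≤ η * b ^ 2) (hK : |K| ≤ η) (hβ : |b ^ 2 - Y| ≤ η)
    (hY : Y ≤ 1) (hη : η ≤ 1) (h0 : 0 ≤ lam) (h2 : lam ≤ 2) :
    |2 * c * b - s * (1 - lam ^ 2 * b ^ 2) - 2 * b ^ 3 * (lam ^ 2 - 1)| ≤ 27 * η * b ^ 3 := by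
  have hη0 : 0 ≤ η := (abs_nonneg K).trans hK
  have hlam : lam ^ 2 ≤ 4 := by nlinarith
  have hb2 : b ^ 2 ≤ 2 := by linarith [(abs_le.1 hβ).2]
  have e : 2 * c * b - s * (1 - lam ^ 2 * b ^ 2) - 2 * b ^ 3 * (lam ^ 2 - 1)
      = 2 * b * (c - 1 - (K - Y)) + 2 * b ^ 3 * lam ^ 2 * (K + (b ^ 2 - Y))
        + (s - 2 * b * (1 + (K - Y) + b ^ 2)) * (lam ^ 2 * b ^ 2 - 1) := by ring
  have t1 : |2 * b * (c - 1 - (K - Y))| ≤ 2 * b * (η * b ^ 2) := by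
    rw [abs_mul, abs_of_pos (by positivity)]
    exact mul_le_mul_of_nonneg_left hc (by positivity)
  have t2 : |2 * b ^ 3 * lam ^ 2 * (K + (b ^ 2 - Y))| ≤ 2 * b ^ 3 * 4 * (η + η) := by
    rw [abs_mul, abs_of_nonneg (by positivity)]
    exact mul_le_mul (mul_le_mul_of_nonneg_left hlam (by positivity))
      ((abs_add_le _ _).trans (add_le_add hK hβ)) (abs_nonneg _) (by positivity)
  have t3 : |(s - 2 * b * (1 + (K - Y) + b ^ 2)) * (lam ^ 2 * b ^ 2 - 1)|
      ≤ η * b ^ 3 * 9 := by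
    rw [abs_mul]
    refine mul_le_mul hs (abs_le.2 ⟨?_, ?_⟩) (abs_nonneg _) (by positivity)
    · nlinarith [mul_nonneg (sq_nonneg lam) (sq_nonneg b)]
    · nlinarith [mul_le_mul hlam hb2 (sq_nonneg b) (by norm_num)]
  rw [e]
  refine (abs_add_three _ _ _).trans ?_
  have e2 : 27 * η * b ^ 3
    = 2 * b * (η * b ^ 2) + 2 * b ^ 3 * 4 * (η + η) + η * b ^ 3 * 9 := by ring
  rw [e2]
  exact add_le_add (add_le_add t1 t2) t3

theorem abs_coefficient_sub_le {c h y κ ε β C : ℝ} (hε : 0 < ε) (hh : 0 < h) (hh1 : h ≤ 1)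
    (hK : |κ| * h ≤ 1 / 2) (hy0 : 0 < y) (hy : y * h ^ 2 ≤ C * β) (h1 : h ^ 2 ≤ C * β)
    (hc : c * (1 - κ * h ^ 2) = 1 - y * h ^ 2 + ε * h ^ 3) :
    |c - 1 - (κ * h ^ 2 - y * h ^ 2)| ≤ h * (2 * C * (|κ| * (|κ| + 1) + ε)) * β := by
  have hKh : |κ * h ^ 2| ≤ |κ| * h := by
    rw [abs_mul, abs_of_nonneg (sq_nonneg h)]
    exact mul_le_mul_of_nonneg_left (by nlinarith) (abs_nonneg κ)
  have hK' : 1 / 2 ≤ 1 - κ * h ^ 2 := by linarith [le_abs_self (κ * h ^ 2)]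
  have e : c - 1 - (κ * h ^ 2 - y * h ^ 2)
      = (κ * h ^ 2 * (κ * h ^ 2 - y * h ^ 2) + ε * h ^ 3) / (1 - κ * h ^ 2) := by
    rw [eq_div_iff (by linarith)]
    linear_combination hc
  have hKY : |κ * h ^ 2 - y * h ^ 2| ≤ (|κ| + 1) * (C * β) := by
    refine (abs_sub _ _).trans ?_
    rw [abs_mul, abs_of_nonneg (sq_nonneg h), abs_of_pos (by positivity : 0 < y * h ^ 2)]
    nlinarith [mul_le_mul_of_nonneg_left h1 (abs_nonneg κ)]
  have hnum : |κ * h ^ 2 * (κ * h ^ 2 - y * h ^ 2) + ε * h ^ 3|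
      ≤ |κ| * h * ((|κ| + 1) * (C * β)) + ε * h * (C * β) := by
    refine (abs_add_le _ _).trans (add_le_add ?_ ?_)
    · rw [abs_mul]
      exact mul_le_mul hKh hKY (abs_nonneg _) (by positivity)
    · rw [abs_of_pos (by positivity)]
      nlinarith [mul_le_mul_of_nonneg_left h1 (mul_pos hε hh).le]
  have hpos : 0 < 1 - κ * h ^ 2 := by linarith
  rw [e, abs_div, abs_of_pos hpos, div_le_iff₀ hpos]
  have : 0 ≤ h * (2 * C * (|κ| * (|κ| + 1) + ε)) * β := by
    have : 0 ≤ C * β := (sq_nonneg h).trans h1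
    have e3 : h * (2 * C * (|κ| * (|κ| + 1) + ε)) * β
      = 2 * h * (|κ| * (|κ| + 1) + ε) * (C * β) := by ring
    rw [e3]; positivity
  nlinarith [mul_le_mul_of_nonneg_left hK' this]

theorem IsPoleSolution.abs_residual_le {κ : ℝ} {U U' : ℝ → ℝ} (hU : IsPoleSolution κ U U')
    {ε ρ : ℝ} (hε : 0 < ε) (hρ : 0 < ρ) :
    ∃ J > 0, ∃ h₀ > 0, ∀ h, 0 < h → h < h₀ → ∀ y, J * h ≤ y → y * h ^ 2 ≤ 1 →
      ∀ c, c * (1 - κ * h ^ 2) = 1 - y * h ^ 2 + ε * h ^ 3 → ∀ lam, 0 ≤ lam → lam ≤ 2 →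
      |2 * c * (h * U y) - (h * U (y + h) + h * U (y - h)) * (1 - lam ^ 2 * (h * U y) ^ 2)
        - 2 * (h * U y) ^ 3 * (lam ^ 2 - 1)| ≤ ρ * (h * U y) ^ 3 := by
  obtain ⟨C, hC, hCU⟩ := profile_bounds hU.pos hU.continuousOn hU.tendsto_zero hU.tendsto_atTop
  obtain ⟨η, hη, hηρ, hη1⟩ : ∃ η > 0, 27 * η ≤ ρ ∧ η ≤ 1 :=
    ⟨min (ρ / 27) 1, by positivity, by linarith [min_le_left (ρ / 27) 1], min_le_right _ _⟩
  set D := 2 * (|κ| + 1) * C + 4 * C + 14 with hD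
  have hD0 : 1 ≤ D := by
    have : 0 ≤ 2 * (|κ| + 1) * C + 4 * C := by positivity
    linarith
  obtain ⟨θ, hθ, hθη, hθ1⟩ : ∃ θ > 0, 2 * (D * θ) ≤ η ∧ θ ≤ 1 := by
    refine ⟨η / (2 * D), by positivity, le_of_eq (by field_simp), ?_⟩
    rw [div_le_one (by positivity)]
    linarith
  obtain ⟨τ, hτ, hτ1, hτU⟩ := profile_slowly_varying hU.pos hU.continuousOn hU.tendsto_zero
    hU.tendsto_atTop hθ
  obtain ⟨J, hJ, h₁, hh₁, hJ'⟩ := hU.abs_sq_sub_le hη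
  set G := 2 * C * (|κ| * (|κ| + 1) + ε) with hG
  have hG0 : 0 < G := by positivity
  refine ⟨max J (1 / min τ θ), by positivity,
    min (min h₁ 1) (min (η / G) (η / 2 / (|κ| + 1))), by positivity, ?_⟩
  intro h hh hh₀ y hy hyh c hc lam hl0 hl2
  have hhh₁ : h < h₁ := hh₀.trans_le ((min_le_left _ _).trans (min_le_left _ _))
  have hh1 : h < 1 := hh₀.trans_le ((min_le_left _ _).trans (min_le_right _ _))
  have hhG : h * G ≤ η := (le_div_iff₀ hG0).1
    (hh₀.le.trans ((min_le_right _ _).trans (min_le_left _ _)))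
  have hhκ : h * (|κ| + 1) ≤ η / 2 := (le_div_iff₀ (by positivity)).1
    (hh₀.le.trans ((min_le_right _ _).trans (min_le_right _ _)))
  have hκh : |κ| * h ≤ η / 2 := by linarith
  have hJy : J * h ≤ y := (mul_le_mul_of_nonneg_right (le_max_left _ _) hh.le).trans hy
  have hhy : h ≤ min τ θ * y := by
    have h1 := (mul_le_mul_of_nonneg_right (le_max_right J (1 / min τ θ)) hh.le).trans hy
    rw [div_mul_eq_mul_div, one_mul, div_le_iff₀ (by positivity)] at h1
    linarith
  have hy0 : 0 < y := (mul_pos hJ hh).trans_le hJy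
  have hhτ : h ≤ τ * y := hhy.trans (mul_le_mul_of_nonneg_right (min_le_left _ _) hy0.le)
  have hhθ : h ≤ θ * y := hhy.trans (mul_le_mul_of_nonneg_right (min_le_right _ _) hy0.le)
  obtain ⟨hyC, h1C, -⟩ := hCU y hy0
  have hu := hU.pos y hy0
  have hξ0 : ∀ ξ, |ξ - y| ≤ h → 0 < ξ := fun ξ hξ => by
    have h1 := (abs_le.1 hξ).1
    have h2 := mul_lt_mul_of_pos_right hτ1 hy0
    linarith
  have hsd := abs_second_difference_sub_le hh.le (fun ξ hξ => hU.hasDerivAt ξ (hξ0 ξ hξ))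
    (fun ξ hξ => hU.hasDerivAt' ξ (hξ0 ξ hξ)) (fun ξ hξ => abs_painleve_rhs_sub_le (κ := κ) hy0 hu
      hC hθ1 hyC h1C (hξ.trans hhθ) (hτU y hy0 ξ (hξ.trans hhτ)))
  rw [← hD] at hsd
  have hb : 0 < h * U y := mul_pos hh hu
  have hs : |(h * U (y + h) + h * U (y - h)) - 2 * (h * U y) *
      (1 + (κ * h ^ 2 - y * h ^ 2) + (h * U y) ^ 2)| ≤ η * (h * U y) ^ 3 := by
    have e : (h * U (y + h) + h * U (y - h)) - 2 * (h * U y) *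
        (1 + (κ * h ^ 2 - y * h ^ 2) + (h * U y) ^ 2)
        = h * (U (y + h) + U (y - h) - 2 * U y
          - h ^ 2 * (2 * (κ - y) * U y + 2 * U y ^ 3)) := by ring
    rw [e, abs_mul, abs_of_pos hh]
    refine (mul_le_mul_of_nonneg_left hsd hh.le).trans ?_
    have : h * (2 * (D * θ * U y ^ 3) * h ^ 2) = 2 * (D * θ) * (h * U y) ^ 3 := by ring
    rw [this]
    exact mul_le_mul_of_nonneg_right hθη (by positivity)
  have hKη : |κ * h ^ 2| ≤ η := by
    rw [abs_mul, abs_of_nonneg (sq_nonneg h)]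
    have := mul_le_mul_of_nonneg_left (pow_le_of_le_one hh.le hh1.le two_ne_zero) (abs_nonneg κ)
    linarith
  have hcc := abs_coefficient_sub_le (β := (h * U y) ^ 2) (C := C) hε hh hh1.le
    (by linarith) hy0
    ((mul_le_mul_of_nonneg_right hyC (sq_nonneg h)).trans_eq (by ring))
    (by simpa [mul_pow, mul_comm, mul_left_comm] using mul_le_mul_of_nonneg_right h1C (sq_nonneg h))
    hc
  rw [← hG] at hcc
  have hmain := abs_discrete_residual_le hb hs
    (hcc.trans (mul_le_mul_of_nonneg_right hhG (sq_nonneg _))) hKη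
    (hJ' h hh hhh₁ y hJy hyh) hyh hη1 hl0 hl2
  exact hmain.trans (mul_le_mul_of_nonneg_right hηρ (by positivity))

theorem discretePainleve_le_of_supersolution {n : ℕ} {A w c : ℕ → ℝ}
    (hw : ∀ j ∈ Finset.Icc 1 (n + 1), 0 < w j) (h1 : A 1 ≤ w 1) (hn : A (n + 1) ≤ w (n + 1))
    (hA : ∀ j, 2 ≤ j → j ≤ n → 0 < A j ∧ A j < 1)
    (hAeq : ∀ j, 2 ≤ j → j ≤ n → (A (j + 1) + A (j - 1)) * (1 - A j ^ 2) = 2 * c j * A j)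
    (hsup : ∀ j, 2 ≤ j → j ≤ n → (w (j + 1) + w (j - 1)) * (1 - w j ^ 2) < 2 * c j * w j) :
    ∀ j ∈ Finset.Icc 1 (n + 1), A j ≤ w j := by
  obtain ⟨i, hi, hmax⟩ := Finset.exists_max_image (Finset.Icc 1 (n + 1)) (fun j => A j / w j)
    ⟨1, by simp⟩
  have hle : ∀ j ∈ Finset.Icc 1 (n + 1), A j ≤ A i / w i * w j := fun j hj =>
    (div_le_iff₀ (hw j hj)).1 (hmax j hj)
  suffices h : A i / w i ≤ 1 from fun j hj =>
    (hle j hj).trans (mul_le_of_le_one_left (hw j hj).le h)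
  by_contra! hθ
  have hwi := hw i hi
  have hlt : w i < A i := (one_lt_div hwi).1 hθ
  rw [Finset.mem_Icc] at hi
  have hi1 : i ≠ 1 := by rintro rfl; linarith
  have hin : i ≠ n + 1 := by rintro rfl; linarith
  have hi2 : 2 ≤ i := by omega
  have hin' : i ≤ n := by omega
  have hp := hle (i + 1) (by rw [Finset.mem_Icc]; omega)
  have hm := hle (i - 1) (by rw [Finset.mem_Icc]; omega)
  have hwp := hw (i + 1) (by rw [Finset.mem_Icc]; omega)
  have hwm := hw (i - 1) (by rw [Finset.mem_Icc]; omega)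
  obtain ⟨hA0, hA1⟩ := hA i hi2 hin'
  set θ := A i / w i with hθdef
  have hAi : A i = θ * w i := by rw [hθdef, div_mul_cancel₀ _ hwi.ne']
  have hθ0 : 0 < θ := one_pos.trans hθ
  have : 2 * c i * A i < 2 * c i * A i := calc
    2 * c i * A i = (A (i + 1) + A (i - 1)) * (1 - A i ^ 2) := (hAeq i hi2 hin').symm
    _ ≤ (θ * w (i + 1) + θ * w (i - 1)) * (1 - A i ^ 2) :=
        mul_le_mul_of_nonneg_right (add_le_add hp hm) (by nlinarith)
    _ ≤ (θ * w (i + 1) + θ * w (i - 1)) * (1 - w i ^ 2) :=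
        mul_le_mul_of_nonneg_left (by nlinarith) (by positivity)
    _ = θ * ((w (i + 1) + w (i - 1)) * (1 - w i ^ 2)) := by ring
    _ < θ * (2 * c i * w i) := mul_lt_mul_of_pos_left (hsup i hi2 hin') hθ0
    _ = 2 * c i * A i := by rw [hAi]; ring
  exact lt_irrefl _ this

theorem discretePainleve_ge_of_subsolution {n : ℕ} {A v c : ℕ → ℝ}
    (hv : ∀ j ∈ Finset.Icc 1 (n + 1), 0 < v j) (h1 : v 1 ≤ A 1) (hn : v (n + 1) ≤ A (n + 1))
    (hA : ∀ j, 2 ≤ j → j ≤ n → 0 < A j ∧ A j < 1)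
    (hAeq : ∀ j, 2 ≤ j → j ≤ n → (A (j + 1) + A (j - 1)) * (1 - A j ^ 2) = 2 * c j * A j)
    (hsub : ∀ j, 2 ≤ j → j ≤ n → 2 * c j * v j < (v (j + 1) + v (j - 1)) * (1 - v j ^ 2)) :
    ∀ j ∈ Finset.Icc 1 (n + 1), v j ≤ A j := by
  obtain ⟨i, hi, hmin⟩ := Finset.exists_min_image (Finset.Icc 1 (n + 1)) (fun j => A j / v j)
    ⟨1, by simp⟩
  have hle : ∀ j ∈ Finset.Icc 1 (n + 1), A i / v i * v j ≤ A j := fun j hj =>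
    (le_div_iff₀ (hv j hj)).1 (hmin j hj)
  suffices h : 1 ≤ A i / v i from fun j hj =>
    (le_mul_of_one_le_left (hv j hj).le h).trans (hle j hj)
  by_contra! hθ
  have hvi := hv i hi
  have hlt : A i < v i := (div_lt_one hvi).1 hθ
  rw [Finset.mem_Icc] at hi
  have hi1 : i ≠ 1 := by rintro rfl; linarith
  have hin : i ≠ n + 1 := by rintro rfl; linarith
  have hi2 : 2 ≤ i := by omega
  have hin' : i ≤ n := by omega
  have hp := hle (i + 1) (by rw [Finset.mem_Icc]; omega)
  have hm := hle (i - 1) (by rw [Finset.mem_Icc]; omega)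
  have hvp := hv (i + 1) (by rw [Finset.mem_Icc]; omega)
  have hvm := hv (i - 1) (by rw [Finset.mem_Icc]; omega)
  obtain ⟨hA0, hA1⟩ := hA i hi2 hin'
  set θ := A i / v i with hθdef
  have hAi : A i = θ * v i := by rw [hθdef, div_mul_cancel₀ _ hvi.ne']
  have hθ0 : 0 < θ := div_pos hA0 hvi
  have : 2 * c i * A i < 2 * c i * A i := calc
    2 * c i * A i = θ * (2 * c i * v i) := by rw [hAi]; ring
    _ < θ * ((v (i + 1) + v (i - 1)) * (1 - v i ^ 2)) :=
        mul_lt_mul_of_pos_left (hsub i hi2 hin') hθ0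
    _ = (θ * v (i + 1) + θ * v (i - 1)) * (1 - v i ^ 2) := by ring
    _ ≤ (θ * v (i + 1) + θ * v (i - 1)) * (1 - A i ^ 2) :=
        mul_le_mul_of_nonneg_left (by nlinarith) (by positivity)
    _ ≤ (A (i + 1) + A (i - 1)) * (1 - A i ^ 2) :=
        mul_le_mul_of_nonneg_right (add_le_add hp hm) (by nlinarith)
    _ = 2 * c i * A i := hAeq i hi2 hin'
  exact lt_irrefl _ this

namespace IsPoleSolution

variable {κ : ℝ} {U U' : ℝ → ℝ}

theorem tendsto_mul_apply_mul (hU : IsPoleSolution κ U U') {x : ℝ} (hx : 0 < x) :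
    Tendsto (fun h => h * U (x * h)) (𝓝[>] 0) (𝓝 (1 / x)) := by
  have h1 : Tendsto (fun h => x * h) (𝓝[>] 0) (𝓝[>] 0) := by
    refine tendsto_nhdsWithin_iff.2 ⟨?_, ?_⟩
    · have : Tendsto (fun h => x * h) (𝓝 0) (𝓝 (x * 0)) := tendsto_id.const_mul x
      rw [mul_zero] at this
      exact this.mono_left nhdsWithin_le_nhds
    · filter_upwards [self_mem_nhdsWithin] with h hh
      exact mul_pos hx hh
  refine ((hU.tendsto_zero.comp h1).div_const x).congr fun h => ?_
  simp only [Function.comp]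
  field_simp

theorem eventually_residual_pos_of_index (hU : IsPoleSolution κ U U') (ε : ℝ) {lam : ℝ}
    (hlam : lam ^ 2 ≠ 1) {j : ℕ} (hj : 2 ≤ j) :
    ∀ᶠ h in 𝓝[>] (0 : ℝ), 0 < (lam ^ 2 - 1) *
      (2 * ((1 - j * h ^ 3 + ε * h ^ 3) / (1 - κ * h ^ 2)) * (h * U (j * h))
        - (h * U ((j + 1) * h) + h * U ((j - 1) * h)) * (1 - lam ^ 2 * (h * U (j * h)) ^ 2)) := by
  have hj2 : (2 : ℝ) ≤ j := by exact_mod_cast hj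
  have hc : Tendsto (fun h : ℝ => (1 - j * h ^ 3 + ε * h ^ 3) / (1 - κ * h ^ 2)) (𝓝[>] 0)
      (𝓝 1) := by
    have : ContinuousAt (fun h : ℝ => (1 - j * h ^ 3 + ε * h ^ 3) / (1 - κ * h ^ 2)) 0 :=
      ContinuousAt.div (by fun_prop) (by fun_prop) (by simp)
    simpa [ContinuousAt] using this.tendsto.mono_left nhdsWithin_le_nhds
  have hb := hU.tendsto_mul_apply_mul (x := j) (by linarith)
  have hp := hU.tendsto_mul_apply_mul (x := j + 1) (by linarith)
  have hm := hU.tendsto_mul_apply_mul (x := j - 1) (by linarith)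
  have hlim := ((((hc.const_mul 2).mul hb)).sub ((hp.add hm).mul
    (((hb.pow 2).const_mul (lam ^ 2)).const_sub 1))).const_mul (lam ^ 2 - 1)
  refine hlim.eventually_const_lt ?_
  have hj0 : (j : ℝ) ≠ 0 := by linarith
  have hj1 : (j : ℝ) + 1 ≠ 0 := by linarith
  have hj3 : (j : ℝ) - 1 ≠ 0 := by linarith
  have e : (lam ^ 2 - 1) * (2 * 1 * (1 / (j : ℝ))
      - (1 / ((j : ℝ) + 1) + 1 / ((j : ℝ) - 1)) * (1 - lam ^ 2 * (1 / (j : ℝ)) ^ 2))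
      = 2 * (lam ^ 2 - 1) ^ 2 / (j * ((j + 1) * (j - 1))) := by
    field_simp
    ring
  rw [e]
  have h0 : 0 < (lam ^ 2 - 1) ^ 2 := by
    have := sub_ne_zero.2 hlam
    positivity
  have h1 : 0 < (j : ℝ) * ((j + 1) * (j - 1)) :=
    mul_pos (by linarith) (mul_pos (by linarith) (by linarith))
  positivity

theorem eventually_residual_pos (hU : IsPoleSolution κ U U') {ε : ℝ} (hε : 0 < ε) {lam : ℝ}
    (h0 : 0 ≤ lam) (h2 : lam ≤ 2) (hlam : lam ^ 2 ≠ 1) :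
    ∀ᶠ h : ℝ in 𝓝[>] 0, ∀ j : ℕ, 2 ≤ j → (j : ℝ) * h ^ 3 ≤ 1 → 0 < (lam ^ 2 - 1) *
      (2 * ((1 - j * h ^ 3 + ε * h ^ 3) / (1 - κ * h ^ 2)) * (h * U (j * h))
        - (h * U ((j + 1) * h) + h * U ((j - 1) * h)) * (1 - lam ^ 2 * (h * U (j * h)) ^ 2)) := by
  have hρ : 0 < |lam ^ 2 - 1| := abs_pos.2 (sub_ne_zero.2 hlam)
  obtain ⟨J, hJ, h₀, hh₀, hres⟩ := hU.abs_residual_le hε hρ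
  have hsmall : ∀ᶠ h in 𝓝[>] (0 : ℝ), ∀ j ∈ Finset.Ico 2 (⌈J⌉₊), 0 < (lam ^ 2 - 1) *
      (2 * ((1 - j * h ^ 3 + ε * h ^ 3) / (1 - κ * h ^ 2)) * (h * U (j * h))
        - (h * U ((j + 1) * h) + h * U ((j - 1) * h)) * (1 - lam ^ 2 * (h * U (j * h)) ^ 2)) :=
    (Finset.eventually_all _).2 fun j hj =>
      hU.eventually_residual_pos_of_index ε hlam (Finset.mem_Ico.1 hj).1
  have hden : ∀ᶠ h in 𝓝[>] (0 : ℝ), 0 < 1 - κ * h ^ 2 := by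
    have : ContinuousAt (fun h : ℝ => 1 - κ * h ^ 2) 0 := by fun_prop
    exact (this.tendsto.mono_left nhdsWithin_le_nhds).eventually_const_lt (by simp)
  filter_upwards [hsmall, hden, Ioo_mem_nhdsGT hh₀] with h hs hd hh j hj hjh
  rcases lt_or_ge j ⌈J⌉₊ with hlt | hge
  · exact hs j (Finset.mem_Ico.2 ⟨hj, hlt⟩)
  have hJj : J ≤ j := Nat.ceil_le.1 hge
  have hr := hres h hh.1 hh.2 (j * h) (mul_le_mul_of_nonneg_right hJj hh.1.le)
    (by linarith [show (j : ℝ) * h * h ^ 2 = j * h ^ 3 by ring])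
    ((1 - j * h ^ 3 + ε * h ^ 3) / (1 - κ * h ^ 2))
    (by rw [div_mul_cancel₀ _ hd.ne']; ring) lam h0 h2
  rw [show (j : ℝ) * h + h = (j + 1) * h by ring, show (j : ℝ) * h - h = (j - 1) * h by ring] at hr
  have hj0 : (0 : ℝ) < j := by positivity
  have hb : 0 < h * U (j * h) := mul_pos hh.1 (hU.pos _ (mul_pos hj0 hh.1))
  set X := 2 * ((1 - j * h ^ 3 + ε * h ^ 3) / (1 - κ * h ^ 2)) * (h * U (j * h))
        - (h * U ((j + 1) * h) + h * U ((j - 1) * h)) * (1 - lam ^ 2 * (h * U (j * h)) ^ 2)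
  set b := h * U (j * h)
  have h3 : |(lam ^ 2 - 1) * (X - 2 * b ^ 3 * (lam ^ 2 - 1))| ≤ (lam ^ 2 - 1) ^ 2 * b ^ 3 := by
    rw [abs_mul, ← sq_abs (lam ^ 2 - 1), sq |lam ^ 2 - 1|, mul_assoc |lam ^ 2 - 1|]
    exact mul_le_mul_of_nonneg_left hr hρ.le
  have h4 : 0 < (lam ^ 2 - 1) ^ 2 * b ^ 3 := by
    have := sub_ne_zero.2 hlam
    positivity
  linarith [(abs_le.1 h3).1,
    show (lam ^ 2 - 1) * (X - 2 * b ^ 3 * (lam ^ 2 - 1))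
      = (lam ^ 2 - 1) * X - 2 * ((lam ^ 2 - 1) ^ 2 * b ^ 3) by ring]

end IsPoleSolution

namespace IsPoleSolution

variable {κ : ℝ} {U U' : ℝ → ℝ}

/-- The left boundary value of the rescaled profile: `h U((n + 1) h) → 1` when `n h³ = 1`. -/
theorem tendsto_mul_apply_succ_mul (hU : IsPoleSolution κ U U') {h : ℕ → ℝ}
    (hpos : ∀ n ≥ 1, 0 < h n) (hcube : ∀ n : ℕ, 1 ≤ n → n * h n ^ 3 = 1)
    (hlim : Tendsto h atTop (𝓝 0)) :
    Tendsto (fun n : ℕ => h n * U ((n + 1) * h n)) atTop (𝓝 1) := by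
  have hinv : Tendsto (fun n => (h n)⁻¹) atTop atTop :=
    Tendsto.inv_tendsto_nhdsGT_zero (tendsto_nhdsWithin_iff.2
      ⟨hlim, (eventually_ge_atTop 1).mono hpos⟩)
  have hy : Tendsto (fun n : ℕ => ((n : ℝ) + 1) * h n) atTop atTop := by
    refine tendsto_atTop_mono' _ ?_ hinv
    filter_upwards [eventually_ge_atTop 1, hlim.eventually_le_const one_pos] with n hn h1
    have hp := hpos n hn
    rw [inv_le_iff_one_le_mul₀ hp]
    nlinarith [hcube n hn, pow_le_of_le_one hp.le h1 (show 3 ≠ 0 by norm_num),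
      mul_nonneg (Nat.cast_nonneg (α := ℝ) n) (mul_nonneg (sq_nonneg (h n)) (sub_nonneg.2 h1))]
  have hs : Tendsto (fun n : ℕ => √(1 + h n ^ 3)) atTop (𝓝 1) := by
    have := ((hlim.pow 3).const_add 1).sqrt
    simpa using this
  have := (hU.tendsto_atTop.comp hy).mul hs
  rw [one_mul] at this
  refine this.congr' ?_
  filter_upwards [eventually_ge_atTop 1] with n hn
  have hp := hpos n hn
  have hyn : 0 < ((n : ℝ) + 1) * h n := by positivity
  have e : √(1 + h n ^ 3) = h n * √(((n : ℝ) + 1) * h n) := by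
    rw [← Real.sqrt_sq hp.le, ← Real.sqrt_mul (sq_nonneg _), Real.sqrt_sq hp.le]
    congr 1
    linear_combination -hcube n hn
  have := (Real.sqrt_pos.2 hyn).ne'
  simp only [Function.comp]
  rw [e]
  field_simp

/-- The solution of the discrete equation, indexed from its right end, is asymptotically
equal to the rescaled profile, uniformly in the index. -/
theorem eventually_ratio_bounds (hU : IsPoleSolution κ U U') {ε : ℝ} (hε : 0 < ε) {h : ℕ → ℝ}
    (hpos : ∀ n ≥ 1, 0 < h n) (hcube : ∀ n : ℕ, 1 ≤ n → n * h n ^ 3 = 1)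
    (hlim : Tendsto h atTop (𝓝 0)) {A : ℕ → ℕ → ℝ}
    (hA1 : ∀ n ≥ 2, A n 1 = 1) (hAn : ∀ n ≥ 2, A n (n + 1) = 1)
    (hA : ∀ n ≥ 2, ∀ j, 2 ≤ j → j ≤ n → 0 < A n j ∧ A n j < 1)
    (hAeq : ∀ n ≥ 2, ∀ j : ℕ, 2 ≤ j → j ≤ n →
      (A n (j + 1) + A n (j - 1)) * (1 - A n j ^ 2)
        = 2 * ((1 - j * h n ^ 3 + ε * h n ^ 3) / (1 - κ * h n ^ 2)) * A n j)
    {δ : ℝ} (hδ : 0 < δ) (hδ1 : δ < 1) :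
    ∀ᶠ n in atTop, ∀ j ∈ Finset.Icc 1 (n + 1),
      |A n j - h n * U (j * h n)| ≤ δ * (h n * U (j * h n)) := by
  have hh : Tendsto h atTop (𝓝[>] 0) :=
    tendsto_nhdsWithin_iff.2 ⟨hlim, (eventually_ge_atTop 1).mono hpos⟩
  have hb1 : Tendsto (fun n => h n * U (1 * h n)) atTop (𝓝 1) := by
    simpa [Function.comp_def] using (hU.tendsto_mul_apply_mul one_pos).comp hh
  have hbn := hU.tendsto_mul_apply_succ_mul hpos hcube hlim
  have hup := hh.eventually (hU.eventually_residual_pos hε (lam := 1 + δ) (by linarith)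
    (by linarith) (by nlinarith))
  have hdn := hh.eventually (hU.eventually_residual_pos hε (lam := 1 - δ) (by linarith)
    (by linarith) (by nlinarith))
  have hup1 : (1 + δ)⁻¹ < 1 := inv_lt_one_of_one_lt₀ (by linarith)
  have hdn1 : 1 < (1 - δ)⁻¹ := (one_lt_inv₀ (by linarith)).2 (by linarith)
  filter_upwards [hup, hdn, hb1.eventually_const_le hup1, hbn.eventually_const_le hup1,
    hb1.eventually_le_const hdn1, hbn.eventually_le_const hdn1, eventually_ge_atTop 2]
    with n hup hdn hu1 hun hd1 hdn' hn
  have hp := hpos n (by omega)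
  have hn3 := hcube n (by omega)
  have hd0 : 0 < 1 - δ := by linarith
  have hu0 : 0 < 1 + δ := by linarith
  rw [inv_le_iff_one_le_mul₀ hu0] at hu1 hun
  rw [← one_div, le_div_iff₀ hd0] at hd1 hdn'
  have hb : ∀ j ∈ Finset.Icc 1 (n + 1), 0 < h n * U (j * h n) := fun j hj => by
    have : (0 : ℝ) < j := by exact_mod_cast (Finset.mem_Icc.1 hj).1
    exact mul_pos hp (hU.pos _ (mul_pos this hp))
  have hjn : ∀ j : ℕ, j ≤ n → (j : ℝ) * h n ^ 3 ≤ 1 := fun j hj => by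
    rw [← hn3]
    gcongr
  have hsub : ∀ j : ℕ, 2 ≤ j → ((j - 1 : ℕ) : ℝ) = (j : ℝ) - 1 := fun j hj => by
    rw [Nat.cast_sub (by omega), Nat.cast_one]
  have hU' := discretePainleve_le_of_supersolution
    (w := fun j : ℕ => (1 + δ) * (h n * U (j * h n)))
    (fun j hj => mul_pos hu0 (hb j hj)) (by rw [hA1 n hn, Nat.cast_one]; linarith)
    (by rw [hAn n hn, Nat.cast_add, Nat.cast_one]; linarith) (hA n hn) (hAeq n hn)
    (fun j hj hjn' => by
      have := pos_of_mul_pos_right (hup j hj (hjn j hjn')) (by nlinarith)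
      rw [Nat.cast_add, Nat.cast_one, hsub j hj]
      nlinarith [mul_pos hu0 this])
  have hD' := discretePainleve_ge_of_subsolution
    (v := fun j : ℕ => (1 - δ) * (h n * U (j * h n)))
    (fun j hj => mul_pos hd0 (hb j hj)) (by rw [hA1 n hn, Nat.cast_one]; linarith)
    (by rw [hAn n hn, Nat.cast_add, Nat.cast_one]; linarith) (hA n hn) (hAeq n hn)
    (fun j hj hjn' => by
      have := neg_of_mul_pos_right (hdn j hj (hjn j hjn')) (by nlinarith)
      rw [Nat.cast_add, Nat.cast_one, hsub j hj]
      nlinarith [mul_neg_of_pos_of_neg hd0 this])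
  intro j hj
  have h1 := hU' j hj
  have h2 := hD' j hj
  rw [abs_le]
  constructor <;> linarith

end IsPoleSolution

theorem isPoleSolution_of_painleveII {σ κ s : ℝ} {q q' q'' : ℝ → ℝ} (hs : 0 < s)
    (hs3 : s ^ 3 = 2) (hκ : κ * s = σ)
    (hd1 : ∀ x < σ, HasDerivAt q (q' x) x)
    (hd2 : ∀ x < σ, HasDerivAt q' (q'' x) x)
    (hode : ∀ x < σ, q'' x = x * q x + 2 * (q x) ^ 3)
    (hasymp : Tendsto (fun x : ℝ => q x / √(-x / 2)) atBot (𝓝 1))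
    (hpole : Tendsto (fun x : ℝ => (x - σ) * q x) (𝓝[<] σ) (𝓝 (-1)))
    (hlow : ∀ x ≤ min σ 0, 0 < q x) :
    IsPoleSolution κ (fun y => s * q (σ - s * y)) (fun y => -(s ^ 2 * q' (σ - s * y))) where
  pos y hy := mul_pos hs
    (painleveII_pos hd1 hd2 hode hpole hlow _ (sub_lt_self σ (mul_pos hs hy)))
  hasDerivAt y hy := by
    have hin : HasDerivAt (fun y => σ - s * y) (-(s * 1)) y :=
      ((hasDerivAt_id y).const_mul s).const_sub σ
    refine (((hd1 _ (sub_lt_self σ (mul_pos hs hy))).comp y hin).const_mul s).congr_deriv ?_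
    ring
  hasDerivAt' y hy := by
    have hin : HasDerivAt (fun y => σ - s * y) (-(s * 1)) y :=
      ((hasDerivAt_id y).const_mul s).const_sub σ
    have hy' : σ - s * y < σ := sub_lt_self σ (mul_pos hs hy)
    refine ((((hd2 _ hy').comp y hin).const_mul (s ^ 2)).neg).congr_deriv ?_
    rw [hode _ hy', ← hκ]
    linear_combination ((κ * s - s * y) * q (κ * s - s * y)) * hs3
  tendsto_zero := by
    have h1 : Tendsto (fun y => σ - s * y) (𝓝[>] 0) (𝓝[<] σ) := by
      refine tendsto_nhdsWithin_iff.2 ⟨?_, ?_⟩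
      · have : ContinuousAt (fun y : ℝ => σ - s * y) 0 := by fun_prop
        simpa [ContinuousAt] using this.tendsto.mono_left nhdsWithin_le_nhds
      · filter_upwards [self_mem_nhdsWithin] with y hy
        exact sub_lt_self σ (mul_pos hs hy)
    have h2 := (hpole.comp h1).neg
    rw [neg_neg] at h2
    refine h2.congr fun y => ?_
    simp only [Function.comp]
    ring
  tendsto_atTop := by
    have h1 : Tendsto (fun y => σ - s * y) atTop atBot :=
      tendsto_atBot_add_const_left _ σ
        (tendsto_neg_atTop_atBot.comp (tendsto_id.const_mul_atTop hs)) |>.congr fun y => by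
          simp [sub_eq_add_neg]
    have h2 : Tendsto (fun y : ℝ => s * √((s - σ * y⁻¹) / 2)) atTop (𝓝 1) := by
      have h3 := ((((tendsto_inv_atTop_zero (𝕜 := ℝ)).const_mul σ).const_sub s).div_const
        2).sqrt.const_mul s
      have e : s * √((s - σ * 0) / 2) = 1 := by
        rw [← Real.sqrt_sq hs.le, mul_zero, sub_zero, ← Real.sqrt_mul (sq_nonneg _),
          Real.sqrt_sq hs.le, Real.sqrt_eq_one]
        linear_combination hs3 / 2
      rwa [e] at h3
    have h3 := (hasymp.comp h1).mul h2
    rw [one_mul] at h3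
    refine h3.congr' ?_
    filter_upwards [eventually_gt_atTop 0, h1.eventually_lt_atBot 0] with y hy hneg
    have hr : 0 < √(-(σ - s * y) / 2) := Real.sqrt_pos.2 (by linarith)
    have hy' : 0 < √y := Real.sqrt_pos.2 hy
    have e : √((s - σ * y⁻¹) / 2) = √(-(σ - s * y) / 2) / √y := by
      rw [← Real.sqrt_div (by linarith)]
      congr 1
      field_simp
      ring
    simp only [Function.comp]
    rw [e]
    generalize √(-(σ - s * y) / 2) = r at hr ⊢
    field_simp

theorem IsPoleSolution.tendsto_discretePainleve {κ : ℝ} {U U' : ℝ → ℝ}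
    (hU : IsPoleSolution κ U U') {ε : ℝ} (hε : 0 < ε) {h : ℕ → ℝ}
    (hpos : ∀ n ≥ 1, 0 < h n) (hcube : ∀ n : ℕ, 1 ≤ n → n * h n ^ 3 = 1)
    (hlim : Tendsto h atTop (𝓝 0)) {a : ℕ → ℤ → ℝ}
    (hsol : ∀ n : ℕ, 2 ≤ n → a n (-1) = 1 ∧ a n ((n : ℤ) - 1) = 1 ∧
      (∀ k : ℤ, 0 ≤ k → k ≤ (n : ℤ) - 2 → a n k ∈ Set.Ioo (0 : ℝ) 1 ∧
        a n (k + 1) + a n (k - 1)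
          = (((k : ℝ) + ε) / ((n : ℝ) - κ * (h n)⁻¹)) * (2 * a n k / (1 - (a n k) ^ 2))))
    {y : ℝ} (hy : 0 < y) {j : ℕ → ℕ} (hj : Tendsto (fun n => j n * h n) atTop (𝓝 y)) :
    Tendsto (fun n => (h n)⁻¹ * a n (n - j n)) atTop (𝓝 (U y)) := by
  have hA : ∀ n ≥ 2, ∀ j : ℕ, 2 ≤ j → j ≤ n → 0 < a n (n - j) ∧ a n (n - j) < 1 :=
    fun n hn j hj hjn => ((hsol n hn).2.2 (n - j) (by omega) (by omega)).1
  have hAeq : ∀ n ≥ 2, ∀ j : ℕ, 2 ≤ j → j ≤ n →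
      (a n (n - (j + 1 : ℕ)) + a n (n - (j - 1 : ℕ))) * (1 - a n (n - j) ^ 2)
        = 2 * ((1 - j * h n ^ 3 + ε * h n ^ 3) / (1 - κ * h n ^ 2)) * a n (n - j) := by
    intro n hn j hj hjn
    have heq := ((hsol n hn).2.2 (n - j) (by omega) (by omega)).2
    obtain ⟨h0, h1⟩ := hA n hn j hj hjn
    have hp := hpos n (by omega)
    have hden : 1 - a n (n - j) ^ 2 ≠ 0 := by nlinarith
    have hc : (((n - j : ℤ) : ℝ) + ε) / ((n : ℝ) - κ * (h n)⁻¹)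
        = (1 - j * h n ^ 3 + ε * h n ^ 3) / (1 - κ * h n ^ 2) := by
      rw [← mul_div_mul_right _ _ (pow_ne_zero 3 hp.ne')]
      congr 1
      · push_cast
        linear_combination hcube n (by omega)
      · have : (h n)⁻¹ * h n ^ 3 = h n ^ 2 := by field_simp
        linear_combination hcube n (by omega) - κ * this
    rw [hc] at heq
    rw [show (n : ℤ) - (j + 1 : ℕ) = n - j - 1 by omega,
      show (n : ℤ) - (j - 1 : ℕ) = n - j + 1 by omega, add_comm, heq]
    field_simp
  have hUy : Tendsto (fun n => U (j n * h n)) atTop (𝓝 (U y)) :=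
    (hU.hasDerivAt y hy).continuousAt.tendsto.comp hj
  have hjpos : ∀ᶠ n in atTop, 1 ≤ j n := by
    filter_upwards [hj.eventually_const_lt hy] with n hn
    rw [Nat.one_le_iff_ne_zero]
    rintro h0
    simp [h0] at hn
  have hjle : ∀ᶠ n in atTop, j n ≤ n := by
    have h0 : Tendsto (fun n => j n * h n * h n ^ 2) atTop (𝓝 0) := by
      simpa using hj.mul (hlim.pow 2)
    filter_upwards [h0.eventually_lt_const one_pos, eventually_ge_atTop 1] with n hn hn1
    have hp := hpos n hn1
    have : (j n : ℝ) * h n ^ 3 < n * h n ^ 3 := by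
      rw [hcube n hn1]
      linarith [show (j n : ℝ) * h n * h n ^ 2 = j n * h n ^ 3 by ring]
    exact_mod_cast (lt_of_mul_lt_mul_right this (by positivity)).le
  have hrel : ∀ δ > 0, δ < 1 →
      ∀ᶠ n in atTop, |(h n)⁻¹ * a n (n - j n) - U (j n * h n)| ≤ δ * U (j n * h n) := by
    intro δ hδ hδ1
    have hb := hU.eventually_ratio_bounds hε hpos hcube hlim
      (A := fun n j => a n (n - j))
      (fun n hn => (hsol n hn).2.1)
      (fun n hn => by
        rw [show (n : ℤ) - (n + 1 : ℕ) = -1 by omega]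
        exact (hsol n hn).1) hA hAeq hδ hδ1
    filter_upwards [hb, hjpos, hjle, eventually_ge_atTop 1] with n hb h1 hn hn1
    have hp := hpos n hn1
    have := hb (j n) (Finset.mem_Icc.2 ⟨h1, by omega⟩)
    have e : (h n)⁻¹ * a n (n - j n) - U (j n * h n)
        = (h n)⁻¹ * (a n (n - j n) - h n * U (j n * h n)) := by field_simp
    rw [e, abs_mul, abs_of_pos (inv_pos.2 hp), inv_mul_le_iff₀ hp]
    linarith
  have hdiff : Tendsto (fun n => (h n)⁻¹ * a n (n - j n) - U (j n * h n)) atTop (𝓝 0) := by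
    rw [Metric.tendsto_nhds]
    intro e he
    have hL := hU.pos y hy
    have hδ : 0 < min (1 / 2) (e / (2 * (U y + 1))) := by positivity
    filter_upwards [hrel _ hδ ((min_le_left _ _).trans_lt (by norm_num)),
      hUy.eventually_lt_const (lt_add_one (U y))] with n h1 h2
    rw [dist_zero_right, Real.norm_eq_abs]
    refine h1.trans_lt ?_
    calc _ ≤ min (1 / 2) (e / (2 * (U y + 1))) * (U y + 1) :=
          mul_le_mul_of_nonneg_left h2.le hδ.le
      _ ≤ e / (2 * (U y + 1)) * (U y + 1) :=
          mul_le_mul_of_nonneg_right (min_le_right _ _) (by positivity)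
      _ = e / 2 := by field_simp
      _ < e := half_lt_self he
  simpa using hdiff.add hUy

/-- Double scaling limit of the discrete Painlevé II equation with boundary
conditions `a_{-1} = a_{n-1} = 1`: with `t_n = n - 2^{-1/3} σ n^{1/3}`, the unique
solution `(a^{(n)}_k)_{k=0}^{n-2} ∈ (0,1)^{n-1}` satisfies
`n^{1/3} a^{(n)}_{n+kₙ} → 2^{1/3} q(2^{1/3} x + σ)` whenever `kₙ/n^{1/3} → x < 0`,
where `q` is the solution of the Painlevé II equation `q'' = xq + 2q³` with
`q(x)/√(-x/2) → 1` as `x → -∞`, a simple pole at `σ` of residue `-1`, and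
`q(x) > √(-x/6)` for `x ≤ min(σ,0)`. -/
theorem dPII_double_scaling_limit (σ ε : ℝ) (hε : 0 < ε)
    (q q' q'' : ℝ → ℝ)
    (hanalytic : AnalyticOn ℝ q (Set.Iio σ))
    (hd1 : ∀ x < σ, HasDerivAt q (q' x) x)
    (hd2 : ∀ x < σ, HasDerivAt q' (q'' x) x)
    (hode : ∀ x < σ, q'' x = x * q x + 2 * (q x) ^ 3)
    (hasymp : Tendsto (fun x : ℝ => q x / Real.sqrt (-x / 2)) atBot (𝓝 1))
    (hpole : Tendsto (fun x : ℝ => (x - σ) * q x) (nhdsWithin σ (Set.Iio σ)) (𝓝 (-1)))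
    (hlow : ∀ x ≤ min σ 0, Real.sqrt (-x / 6) < q x)
    (a : ℕ → ℤ → ℝ)
    (hsol : ∀ n : ℕ, 2 ≤ n →
      a n (-1) = 1 ∧ a n ((n : ℤ) - 1) = 1 ∧
      (∀ k : ℤ, 0 ≤ k → k ≤ (n : ℤ) - 2 →
        a n k ∈ Set.Ioo (0 : ℝ) 1 ∧
        a n (k + 1) + a n (k - 1)
          = (((k : ℝ) + ε) / ((n : ℝ) - (2 : ℝ) ^ (-(1 : ℝ) / 3) * σ * (n : ℝ) ^ ((1 : ℝ) / 3)))
            * (2 * a n k / (1 - (a n k) ^ 2)))) :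
    ∀ x : ℝ, x < 0 → ∀ k : ℕ → ℤ,
      Tendsto (fun n : ℕ => (k n : ℝ) / (n : ℝ) ^ ((1 : ℝ) / 3)) atTop (𝓝 x) →
      Tendsto (fun n : ℕ => (n : ℝ) ^ ((1 : ℝ) / 3) * a n ((n : ℤ) + k n)) atTop
        (𝓝 ((2 : ℝ) ^ ((1 : ℝ) / 3) * q ((2 : ℝ) ^ ((1 : ℝ) / 3) * x + σ))) := by
  intro x hx k hk
  set s : ℝ := (2 : ℝ) ^ ((1 : ℝ) / 3) with hs_def
  have hs : 0 < s := by positivity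
  have hs3 : s ^ 3 = 2 := by
    rw [hs_def, ← Real.rpow_natCast, ← Real.rpow_mul (by norm_num)]
    norm_num
  have hκ : (2 : ℝ) ^ (-(1 : ℝ) / 3) * σ * s = σ := by
    rw [mul_right_comm, hs_def, ← Real.rpow_add (by norm_num)]
    norm_num
  have hU := isPoleSolution_of_painleveII hs hs3 hκ hd1 hd2 hode hasymp hpole
    fun z hz => (Real.sqrt_nonneg _).trans_lt (hlow z hz)
  have hN : Tendsto (fun n : ℕ => (n : ℝ) ^ ((1 : ℝ) / 3)) atTop atTop :=
    (tendsto_rpow_atTop (by norm_num)).comp tendsto_natCast_atTop_atTop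
  have hkneg : ∀ᶠ n in atTop, k n < 0 := by
    filter_upwards [hk.eventually_lt_const hx] with n hn
    by_contra! h0
    have : (0 : ℝ) ≤ k n := by exact_mod_cast h0
    exact absurd hn (not_lt.2 (by positivity))
  have hj : Tendsto (fun n : ℕ => (((-k n).toNat : ℕ) : ℝ) * ((n : ℝ) ^ ((1 : ℝ) / 3))⁻¹)
      atTop (𝓝 (-x)) := by
    refine hk.neg.congr' ?_
    filter_upwards [hkneg] with n hn
    have : (((-k n).toNat : ℕ) : ℝ) = -(k n : ℝ) := by
      exact_mod_cast Int.toNat_of_nonneg (show 0 ≤ -k n by omega)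
    rw [this, neg_mul, div_eq_mul_inv]
  have hmain := hU.tendsto_discretePainleve hε
    (h := fun n => ((n : ℝ) ^ ((1 : ℝ) / 3))⁻¹)
    (fun n hn => by
      have : (0 : ℝ) < n := by exact_mod_cast hn
      positivity)
    (fun n hn => by
      have h0 : (0 : ℝ) < n := by exact_mod_cast hn
      rw [inv_pow, ← Real.rpow_natCast, ← Real.rpow_mul h0.le]
      norm_num
      exact mul_inv_cancel₀ h0.ne')
    hN.inv_tendsto_atTop (a := a) (by simpa only [inv_inv] using hsol) (neg_pos.2 hx) hj
  simp only [inv_inv] at hmain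
  rw [show σ - s * -x = s * x + σ by ring] at hmain
  refine hmain.congr' ?_
  filter_upwards [hkneg] with n hn
  rw [Int.toNat_of_nonneg (by omega), sub_neg_eq_add]
end

section
/- Let ω ∈ ℝ and δ > 0, and let g : (−δ, δ) → ℝ be real-analytic such that the function ν(x) = −1/x + g(x) satisfies ν''(x) = 2(x+ω)·ν(x) + 2ν(x)³ for all x ∈ (−δ, δ) with x ≠ 0 (so ν is a solution with a simple pole at 0 of residue −1). Then g(0) = 0, g'(0) = ω/3 and g''(0) = 1; equivalently, x·ν(x) + 1 − (ω/3)x² − x³/2 = O(x⁴) as x → 0. -/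
open Filter Topology in
/-- Second derivative of a function with a simple pole of residue `-1` at `0`. -/
theorem deriv_deriv_neg_inv_add {g : ℝ → ℝ} {x : ℝ} (hx : x ≠ 0) (hg : AnalyticAt ℝ g x) :
    deriv (deriv (fun y : ℝ => -1 / y + g y)) x = -2 / x ^ 3 + deriv (deriv g) x := by
  have h : deriv (fun y : ℝ => -1 / y + g y) =ᶠ[𝓝 x] fun y => 1 / y ^ 2 + deriv g y := by
    filter_upwards [hg.eventually_analyticAt, eventually_ne_nhds hx] with y hy hy0
    exact (((hasDerivAt_const y (-1 : ℝ)).div (hasDerivAt_id y) hy0).add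
      hy.differentiableAt.hasDerivAt).deriv.trans (by simp)
  rw [h.deriv_eq]
  refine (((hasDerivAt_const x (1 : ℝ)).div ((hasDerivAt_id x).pow 2) (pow_ne_zero 2 hx)).add
    hg.deriv.differentiableAt.hasDerivAt).deriv.trans ?_
  simp
  field_simp

open Filter Topology in
/-- The Taylor coefficients of `g` up to second order are determined by the regularized
form of the shifted Painlevé II equation at a pole. -/
theorem taylor_coeffs_of_regularized_shiftedPII {ω : ℝ} {g : ℝ → ℝ} (hg : AnalyticAt ℝ g 0)
    (h : ∀ᶠ x in 𝓝 0, 6 * g x - 6 * (x * g x ^ 2) + 2 * (x ^ 2 * g x ^ 3)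
      + 2 * ((x + ω) * (x ^ 2 * g x - x)) - x ^ 2 * deriv (deriv g) x = 0) :
    g 0 = 0 ∧ deriv g 0 = ω / 3 ∧ deriv (deriv g) 0 = 1 := by
  have h0 : g 0 = 0 := by simpa using h.self_of_nhds
  have hd : ∀ᶠ x in 𝓝 0, 6 * deriv g x - 6 * (g x ^ 2 + x * (2 * g x * deriv g x))
      + 2 * (2 * x * g x ^ 3 + x ^ 2 * (3 * g x ^ 2 * deriv g x))
      + 2 * ((x ^ 2 * g x - x) + (x + ω) * (2 * x * g x + x ^ 2 * deriv g x - 1))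
      - (2 * x * deriv (deriv g) x + x ^ 2 * deriv (deriv (deriv g)) x) = 0 := by
    filter_upwards [h.eventually_nhds, hg.eventually_analyticAt] with x hx hgx
    have d0 := hgx.differentiableAt.hasDerivAt
    have d2 := hgx.deriv.deriv.differentiableAt.hasDerivAt
    have i := hasDerivAt_id x
    have key := ((((d0.const_mul 6).sub ((i.mul (d0.pow 2)).const_mul 6)).add
      (((i.pow 2).mul (d0.pow 3)).const_mul 2)).add
      (((i.add_const ω).mul (((i.pow 2).mul d0).sub i)).const_mul 2)).sub ((i.pow 2).mul d2)
    have z := key.unique ((hasDerivAt_const x (0 : ℝ)).congr_of_eventuallyEq hx)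
    simp at z
    linear_combination z
  have h1 : deriv g 0 = ω / 3 := by
    have := hd.self_of_nhds
    simp [h0] at this
    linarith
  refine ⟨h0, h1, ?_⟩
  have d0 := hg.differentiableAt.hasDerivAt
  have d1 := hg.deriv.differentiableAt.hasDerivAt
  have d2 := hg.deriv.deriv.differentiableAt.hasDerivAt
  have d3 := hg.deriv.deriv.deriv.differentiableAt.hasDerivAt
  have i := hasDerivAt_id (0 : ℝ)
  have key := (((((d1.const_mul 6).sub
    (((d0.pow 2).add (i.mul ((d0.const_mul 2).mul d1))).const_mul 6)).add
    ((((i.const_mul 2).mul (d0.pow 3)).add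
      ((i.pow 2).mul (((d0.pow 2).const_mul 3).mul d1))).const_mul 2)).add
    (((((i.pow 2).mul d0).sub i).add ((i.add_const ω).mul
      ((((i.const_mul 2).mul d0).add ((i.pow 2).mul d1)).sub_const 1))).const_mul 2)).sub
    (((i.const_mul 2).mul d2).add ((i.pow 2).mul d3)))
  have z := key.unique ((hasDerivAt_const (0 : ℝ) (0 : ℝ)).congr_of_eventuallyEq hd)
  simp [h0] at z
  linarith

/-- Expansion at the pole: if `ν(x) = -1/x + g(x)`, with `g` real-analytic on
`(-δ, δ)`, solves the shifted Painlevé II equation `ν'' = 2(x+ω)ν + 2ν³` on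
`(-δ, δ) \ {0}` (so `ν` has a simple pole at `0` with residue `-1`), then
`g(0) = 0`, `g'(0) = ω/3` and `g''(0) = 1`. -/
theorem shiftedPII_pole_expansion (ω δ : ℝ) (hδ : 0 < δ) (g : ℝ → ℝ)
    (hg : AnalyticOn ℝ g (Set.Ioo (-δ) δ))
    (hode : ∀ x ∈ Set.Ioo (-δ) δ, x ≠ 0 →
      deriv (deriv (fun y : ℝ => -1 / y + g y)) x
        = 2 * (x + ω) * (-1 / x + g x) + 2 * (-1 / x + g x) ^ 3) :
    g 0 = 0 ∧ deriv g 0 = ω / 3 ∧ deriv (deriv g) 0 = 1 := by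
  have hU : Set.Ioo (-δ) δ ∈ nhds (0 : ℝ) := Ioo_mem_nhds (by linarith) hδ
  have hgU := isOpen_Ioo.analyticOn_iff_analyticOnNhd.1 hg
  have hg0 : AnalyticAt ℝ g 0 := hgU 0 (mem_of_mem_nhds hU)
  refine taylor_coeffs_of_regularized_shiftedPII (ω := ω) hg0 ?_
  have c0 := hg0.continuousAt
  have c2 := hg0.deriv.deriv.continuousAt
  refine (ContinuousAt.eventuallyEq_nhds_iff_eventuallyEq_nhdsNE
    (by fun_prop) continuousAt_const).1 ?_
  filter_upwards [mem_nhdsWithin_of_mem_nhds hU, self_mem_nhdsWithin] with x hx hx0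
  have hx0 : x ≠ 0 := hx0
  have e := hode x hx hx0
  rw [deriv_deriv_neg_inv_add hx0 (hgU x hx)] at e
  field_simp at e
  apply mul_left_cancel₀ hx0
  linear_combination -e
end

section
/- Let E be a real Banach space, let X ⊆ E be open and convex, and let F : X → E be Fréchet differentiable on X. Let x₀ ∈ X be such that F'(x₀) is invertible as a continuous linear map with continuous inverse. Suppose there exist constants β, M > 0 such that: (1) ‖F'(x₀)^{−1} F(x₀)‖ ≤ β; (2) the open ball B(x₀, 2β) is contained in X and ‖F'(x₀)^{−1}(F'(x) − F'(y))‖ ≤ M·‖x − y‖ for all x, y ∈ B(x₀, 2β) (operator norm on the left); and (3) β·M < 1/2. Then, setting t* = 2β/(1 + √(1 − 2βM)), there exists x* in the closed ball of radius t* centered at x₀ with F(x*) = 0 (and t* < 2β). -/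
/-- If `‖T' x‖ ≤ M * ‖x - x₀‖` for `x` in a ball around `x₀`, then
`‖T x - T x₀‖ ≤ M / 2 * ‖x - x₀‖ ^ 2` on that ball. -/
theorem norm_image_sub_center_le_of_norm_hasFDerivAt_le {E G : Type*}
    [NormedAddCommGroup E] [NormedSpace ℝ E] [NormedAddCommGroup G] [NormedSpace ℝ G]
    {T : E → G} {T' : E → E →L[ℝ] G} {x₀ : E} {r M : ℝ}
    (hT : ∀ x ∈ Metric.ball x₀ r, HasFDerivAt T (T' x) x)
    (hT' : ∀ x ∈ Metric.ball x₀ r, ‖T' x‖ ≤ M * ‖x - x₀‖)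
    {x : E} (hx : x ∈ Metric.ball x₀ r) :
    ‖T x - T x₀‖ ≤ M / 2 * ‖x - x₀‖ ^ 2 := by
  have hmem : ∀ t ∈ Set.Icc (0 : ℝ) 1, x₀ + t • (x - x₀) ∈ Metric.ball x₀ r := by
    intro t ht
    have hr : ‖x - x₀‖ < r := by simpa [dist_eq_norm] using hx
    rw [Metric.mem_ball, dist_eq_norm, add_sub_cancel_left, norm_smul, Real.norm_of_nonneg ht.1]
    exact (mul_le_of_le_one_left (norm_nonneg _) ht.2).trans_lt hr
  have hderiv : ∀ t ∈ Set.Icc (0 : ℝ) 1, HasDerivAt (fun t : ℝ => T (x₀ + t • (x - x₀)) - T x₀)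
      (T' (x₀ + t • (x - x₀)) (x - x₀)) t := by
    intro t ht
    have hline : HasDerivAt (fun t : ℝ => x₀ + t • (x - x₀)) (x - x₀) t := by
      simpa using ((hasDerivAt_id t).smul_const (x - x₀)).const_add x₀
    exact ((hT _ (hmem t ht)).comp_hasDerivAt t hline).sub_const _
  have hB : ∀ t : ℝ, HasDerivAt (fun t : ℝ => M / 2 * ‖x - x₀‖ ^ 2 * t ^ 2)
      (M * ‖x - x₀‖ ^ 2 * t) t := by
    intro t
    refine ((hasDerivAt_pow 2 t).const_mul _).congr_deriv ?_
    norm_num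
    ring
  have h := image_norm_le_of_norm_deriv_right_le_deriv_boundary
    (fun t ht => (hderiv t ht).continuousAt.continuousWithinAt)
    (fun t ht => (hderiv t (Set.Ico_subset_Icc_self ht)).hasDerivWithinAt)
    (by simp) hB (fun t ht => ?_) (Set.right_mem_Icc.2 (zero_le_one (α := ℝ)))
  · simpa using h
  · refine (ContinuousLinearMap.le_of_opNorm_le _
      (hT' _ (hmem t (Set.Ico_subset_Icc_self ht))) _).trans_eq ?_
    rw [add_sub_cancel_left, norm_smul, Real.norm_of_nonneg ht.1]
    ring

/-- Kantorovich theorem for Newton's method in a Banach space: if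
`‖F'(x₀)⁻¹ F(x₀)‖ ≤ β`, the ball `B(x₀, 2β)` lies in `X` and
`‖F'(x₀)⁻¹ (F'(x) - F'(y))‖ ≤ M‖x - y‖` on it, and `βM < 1/2`, then `F` has a
zero in the closed ball of radius `t* = 2β/(1 + √(1 - 2βM)) < 2β` around `x₀`. -/
theorem kantorovich (E : Type*) [NormedAddCommGroup E] [NormedSpace ℝ E] [CompleteSpace E]
    (X : Set E) (hX : IsOpen X) (hconv : Convex ℝ X)
    (F : E → E) (F' : E → E →L[ℝ] E)
    (hF : ∀ x ∈ X, HasFDerivAt F (F' x) x)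
    (x₀ : E) (hx₀ : x₀ ∈ X)
    (A : E ≃L[ℝ] E) (hA : (A : E →L[ℝ] E) = F' x₀)
    (β M : ℝ) (hβ : 0 < β) (hM : 0 < M)
    (h1 : ‖(A.symm : E →L[ℝ] E) (F x₀)‖ ≤ β)
    (hball : Metric.ball x₀ (2 * β) ⊆ X)
    (h2 : ∀ x ∈ Metric.ball x₀ (2 * β), ∀ y ∈ Metric.ball x₀ (2 * β),
      ‖(A.symm : E →L[ℝ] E).comp (F' x - F' y)‖ ≤ M * ‖x - y‖)
    (h3 : β * M < 1 / 2) :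
    2 * β / (1 + Real.sqrt (1 - 2 * β * M)) < 2 * β ∧
      ∃ xs ∈ Metric.closedBall x₀ (2 * β / (1 + Real.sqrt (1 - 2 * β * M))), F xs = 0 := by
  set s := Real.sqrt (1 - 2 * β * M)
  have hs_pos : 0 < s := Real.sqrt_pos.2 (by linarith)
  have hs_sq : s ^ 2 = 1 - 2 * β * M := Real.sq_sqrt (by linarith)
  set r := 2 * β / (1 + s) with hr
  have hr_pos : 0 < r := by positivity
  have hr_mul : r * (1 + s) = 2 * β := by rw [hr]; field_simp
  have hr_lt : r < 2 * β := by nlinarith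
  have hMr : M * r = 1 - s := by
    have : (1 + s) * (M * r - (1 - s)) = 0 := by linear_combination M * hr_mul + hs_sq
    rcases mul_eq_zero.1 this with h | h <;> linarith
  have hroot : M / 2 * r ^ 2 + β = r := by
    linear_combination r / 2 * hMr - hr_mul / 2
  refine ⟨hr_lt, ?_⟩
  let T : E → E := fun x => x - A.symm (F x)
  let T' : E → E →L[ℝ] E := fun x =>
    ContinuousLinearMap.id ℝ E - (A.symm : E →L[ℝ] E).comp (F' x)
  have hsub : Metric.closedBall x₀ r ⊆ Metric.ball x₀ (2 * β) :=
    Metric.closedBall_subset_ball hr_lt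
  have hT : ∀ x ∈ Metric.ball x₀ (2 * β), HasFDerivAt T (T' x) x := fun x hx =>
    (hasFDerivAt_id x).sub ((A.symm : E →L[ℝ] E).hasFDerivAt.comp x (hF x (hball hx)))
  have hT' : ∀ x ∈ Metric.ball x₀ (2 * β), ‖T' x‖ ≤ M * ‖x - x₀‖ := by
    intro x hx
    have hT'x : T' x = (A.symm : E →L[ℝ] E).comp (F' x₀ - F' x) := by
      ext v
      simp [T', ← hA]
    rw [hT'x, norm_sub_rev x]
    exact h2 x₀ (Metric.mem_ball_self (by positivity)) x hx
  have hmaps : Set.MapsTo T (Metric.closedBall x₀ r) (Metric.closedBall x₀ r) := by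
    intro x hx
    have hquad := norm_image_sub_center_le_of_norm_hasFDerivAt_le hT hT' (hsub hx)
    have hx₀' : ‖T x₀ - x₀‖ ≤ β := by simpa [T] using h1
    rw [mem_closedBall_iff_norm] at hx ⊢
    calc ‖T x - x₀‖ ≤ ‖T x - T x₀‖ + ‖T x₀ - x₀‖ := norm_sub_le_norm_sub_add_norm_sub _ _ _
      _ ≤ M / 2 * r ^ 2 + β := by
        refine add_le_add (hquad.trans ?_) hx₀'
        gcongr
      _ = r := hroot
  have hlip : LipschitzOnWith (M * r).toNNReal T (Metric.closedBall x₀ r) := by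
    refine (convex_closedBall x₀ r).lipschitzOnWith_of_nnnorm_hasFDerivWithin_le
      (fun x hx => (hT x (hsub hx)).hasFDerivWithinAt) fun x hx => ?_
    rw [← NNReal.coe_le_coe, coe_nnnorm, Real.coe_toNNReal _ (by positivity)]
    refine (hT' x (hsub hx)).trans ?_
    rw [mem_closedBall_iff_norm] at hx
    gcongr
  have hcontr : ContractingWith (M * r).toNNReal (hmaps.restrict T _ _) :=
    ⟨Real.toNNReal_lt_one.2 (by linarith), hlip.mapsToRestrict hmaps⟩
  obtain ⟨y, hy, hfix, -⟩ := hcontr.exists_fixedPoint' Metric.isClosed_closedBall.isComplete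
    hmaps (Metric.mem_closedBall_self hr_pos.le) (edist_ne_top _ _)
  refine ⟨y, hy, ?_⟩
  have hzero : A.symm (F y) = 0 := sub_eq_self.1 hfix
  exact (map_eq_zero_iff A.symm A.symm.injective).1 hzero
end
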